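/- arXiv:1610.02202 — 3 statements merged into one kernel-verified Lean document; each statement's English description precedes it below -/
import Mathlib

section
/- Let Ω ⊂ ℝⁿ be a compact convex domain with smooth boundary, α : ∂Ω → ℝ smooth, and let u : closure(Ω) × [0,T) → ℝ be a smooth solution of graphical spacelike mean curvature flow with α-Neumann boundary condition, with initial value u₀. Then for all (x,t) ∈ closure(Ω) × [0,T), |u(x,t)| ≤ sup_{Ω}|u₀| + t·C_H, where C_H := sup_{x∈Ω} |u_t(x,0)|. -/
open Set

noncomputable section

/-- The `i`-th spatial partial derivative (within `closure Ω`) of `u(·,t)`,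
i.e. `Dᵢu(x,t)`. -/
def spGrad {n : ℕ} (Ω : Set (Fin n → ℝ)) (u : (Fin n → ℝ) → ℝ → ℝ)
    (x : Fin n → ℝ) (t : ℝ) (i : Fin n) : ℝ :=
  fderivWithin ℝ (fun y => u y t) (closure Ω) x (Pi.single i 1)

/-- `|Du(x,t)|²`. -/
def spGradSq {n : ℕ} (Ω : Set (Fin n → ℝ)) (u : (Fin n → ℝ) → ℝ → ℝ)
    (x : Fin n → ℝ) (t : ℝ) : ℝ :=
  ∑ i, (spGrad Ω u x t i) ^ 2

/-- `u` is a smooth solution of graphical spacelike mean curvature flow on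
`closure Ω × J` with `α`-Neumann boundary condition, where `γ` is the outward
unit normal of `∂Ω`:  `|Du| < 1` (spacelike),
`u_t = √(1-|Du|²) ∑ᵢ Dᵢ(Dᵢu/√(1-|Du|²))` on `Ω × J`, and
`γ·Du = α √(1-|Du|²)` on `∂Ω × J`. -/
structure IsGraphMCF {n : ℕ} (Ω : Set (Fin n → ℝ)) (γ : (Fin n → ℝ) → Fin n → ℝ)
    (α : (Fin n → ℝ) → ℝ) (J : Set ℝ) (u : (Fin n → ℝ) → ℝ → ℝ) : Prop where
  smooth : ContDiffOn ℝ (⊤ : ℕ∞) (fun q : (Fin n → ℝ) × ℝ => u q.1 q.2) ((closure Ω) ×ˢ J)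
  spacelike : ∀ x ∈ closure Ω, ∀ t ∈ J, spGradSq Ω u x t < 1
  pde : ∀ x ∈ Ω, ∀ t ∈ J,
      derivWithin (fun s => u x s) J t =
        Real.sqrt (1 - spGradSq Ω u x t) *
          ∑ i, fderivWithin ℝ
            (fun y => spGrad Ω u y t i / Real.sqrt (1 - spGradSq Ω u y t))
            (closure Ω) x (Pi.single i 1)
  neumann : ∀ x ∈ frontier Ω, ∀ t ∈ J,
      (∑ i, γ x i * spGrad Ω u x t i) = α x * Real.sqrt (1 - spGradSq Ω u x t)


/-- The map `p ↦ p / √(1 - ‖p‖²)` is strongly monotone on the open unit ball. -/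
lemma sq_norm_sub_le_inner_unitField {V : Type*} [NormedAddCommGroup V] [InnerProductSpace ℝ V]
    {p q : V} {v w : ℝ} (hv : 0 < v) (hw : 0 < w) (hv1 : v ≤ 1) (hw1 : w ≤ 1)
    (hp : ‖p‖ ^ 2 = 1 - v ^ 2) (hq : ‖q‖ ^ 2 = 1 - w ^ 2) :
    ‖p - q‖ ^ 2 ≤ inner ℝ (v⁻¹ • p - w⁻¹ • q) (p - q) := by
  have hD := norm_sub_sq_real p q
  have key : inner ℝ (v⁻¹ • p - w⁻¹ • q) (p - q) =
      (v⁻¹ + w⁻¹) * ‖p - q‖ ^ 2 / 2 + (v + w) * (v - w) ^ 2 / (2 * v * w) := by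
    simp only [inner_sub_left, inner_sub_right, real_inner_smul_left, real_inner_self_eq_norm_sq,
      real_inner_comm p q]
    rw [hD, hp, hq]
    field_simp
    ring
  have h1 : 1 ≤ v⁻¹ := (one_le_inv₀ hv).2 hv1
  have h2 : 1 ≤ w⁻¹ := (one_le_inv₀ hw).2 hw1
  have h3 : 0 ≤ (v + w) * (v - w) ^ 2 / (2 * v * w) := by positivity
  rw [key]
  nlinarith [sq_nonneg ‖p - q‖]

/-- The map `p ↦ p / √(1 - ‖p‖²)` is Lipschitz where `√(1 - ‖p‖²)` is bounded below. -/
lemma norm_unitField_sub_le {V : Type*} [NormedAddCommGroup V] [InnerProductSpace ℝ V]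
    {p q : V} {c v w : ℝ} (hc : 0 < c) (hv : c ≤ v) (hw : c ≤ w)
    (hp : ‖p‖ ^ 2 = 1 - v ^ 2) (hq : ‖q‖ ^ 2 = 1 - w ^ 2) :
    ‖v⁻¹ • p - w⁻¹ • q‖ ≤ (c⁻¹ + (c ^ 3)⁻¹) * ‖p - q‖ := by
  have hv0 : 0 < v := hc.trans_le hv
  have hw0 : 0 < w := hc.trans_le hw
  have hp1 : ‖p‖ ≤ 1 := by nlinarith [norm_nonneg p]
  have hq1 : ‖q‖ ≤ 1 := by nlinarith [norm_nonneg q]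
  have hsplit : v⁻¹ • p - w⁻¹ • q = v⁻¹ • (p - q) + (v⁻¹ - w⁻¹) • q := by module
  have hvw : |v - w| * (v + w) ≤ 2 * ‖p - q‖ := by
    have h1 : |v - w| * (v + w) = |‖q‖ - ‖p‖| * (‖q‖ + ‖p‖) := by
      rw [← abs_of_pos (add_pos hv0 hw0), ← abs_mul,
        ← abs_of_nonneg (add_nonneg (norm_nonneg q) (norm_nonneg p)), ← abs_mul]
      congr 1
      nlinarith
    rw [h1]
    have h2 : |‖q‖ - ‖p‖| ≤ ‖p - q‖ := by
      rw [norm_sub_rev]; exact abs_norm_sub_norm_le q p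
    nlinarith [abs_nonneg (‖q‖ - ‖p‖), norm_nonneg p, norm_nonneg q, norm_nonneg (p - q)]
  have hvw' : |v - w| ≤ ‖p - q‖ / c := by
    rw [le_div_iff₀ hc]
    nlinarith [abs_nonneg (v - w)]
  have hinv : |v⁻¹ - w⁻¹| ≤ (c ^ 3)⁻¹ * ‖p - q‖ := by
    rw [inv_sub_inv hv0.ne' hw0.ne', abs_div, abs_sub_comm, abs_of_pos (mul_pos hv0 hw0)]
    calc |v - w| / (v * w) ≤ (‖p - q‖ / c) / (c * c) := by gcongr
      _ = (c ^ 3)⁻¹ * ‖p - q‖ := by field_simp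
  rw [hsplit]
  calc ‖v⁻¹ • (p - q) + (v⁻¹ - w⁻¹) • q‖ ≤ v⁻¹ * ‖p - q‖ + |v⁻¹ - w⁻¹| * ‖q‖ := by
        refine (norm_add_le _ _).trans ?_
        rw [norm_smul, norm_smul, Real.norm_eq_abs, Real.norm_eq_abs, abs_of_pos (inv_pos.2 hv0)]
    _ ≤ c⁻¹ * ‖p - q‖ + ((c ^ 3)⁻¹ * ‖p - q‖) * 1 := by gcongr
    _ = (c⁻¹ + (c ^ 3)⁻¹) * ‖p - q‖ := by ring

/-- Two spacelike gradients with the same boundary angle cannot differ by a positive multiple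
of a vector that is close to the unit normal. -/
lemma false_of_same_angle {V : Type*} [NormedAddCommGroup V] [InnerProductSpace ℝ V]
    {p q g e : V} {a c v w κ δ : ℝ} (hc : 0 < c) (hv : c ≤ v) (hw : c ≤ w)
    (hp : ‖p‖ ^ 2 = 1 - v ^ 2) (hq : ‖q‖ ^ 2 = 1 - w ^ 2) (hg : ‖g‖ = 1)
    (hgp : inner ℝ g p = a * v) (hgq : inner ℝ g q = a * w)
    (hκ : 0 < κ) (he : ‖e‖ ≤ δ) (hδ : δ * (1 + (c⁻¹ + (c ^ 3)⁻¹)) < 1)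
    (hpq : p - q = κ • (g + e)) : False := by
  have hv0 : 0 < v := hc.trans_le hv
  have hw0 : 0 < w := hc.trans_le hw
  have hv1 : v ≤ 1 := by nlinarith [sq_nonneg ‖p‖]
  have hw1 : w ≤ 1 := by nlinarith [sq_nonneg ‖q‖]
  have hmono := sq_norm_sub_le_inner_unitField hv0 hw0 hv1 hw1 hp hq
  have hlip := norm_unitField_sub_le hc hv hw hp hq
  set L := c⁻¹ + (c ^ 3)⁻¹
  have hL : 0 < L := by positivity
  set F := v⁻¹ • p - w⁻¹ • q
  have hFg : inner ℝ F g = 0 := by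
    simp only [F, inner_sub_left, real_inner_smul_left]
    rw [real_inner_comm, real_inner_comm g q, hgp, hgq]
    field_simp
    ring
  have hFe : inner ℝ F e ≤ L * ‖p - q‖ * δ :=
    (real_inner_le_norm F e).trans
      (mul_le_mul hlip he (norm_nonneg _) (by positivity))
  have hFd : inner ℝ F (p - q) = κ * inner ℝ F e := by
    rw [hpq, real_inner_smul_right, inner_add_right, hFg, zero_add]
  have hge : 1 - δ ≤ ‖g + e‖ := by
    have := norm_sub_le_norm_add g e
    linarith
  have hd : ‖p - q‖ = κ * ‖g + e‖ := by
    rw [hpq, norm_smul, Real.norm_eq_abs, abs_of_pos hκ]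
  have hδ0 : 0 ≤ δ := (norm_nonneg e).trans he
  have hge0 : 0 < ‖g + e‖ := by nlinarith [mul_nonneg hδ0 hL.le]
  have hd0 : 0 < ‖p - q‖ := by rw [hd]; positivity
  have h1 : ‖p - q‖ ^ 2 ≤ κ * (L * ‖p - q‖ * δ) := by
    rw [hFd] at hmono
    exact hmono.trans (mul_le_mul_of_nonneg_left hFe hκ.le)
  have h2 : ‖p - q‖ ≤ κ * (L * δ) := by
    refine le_of_mul_le_mul_right ?_ hd0
    nlinarith
  rw [hd] at h2
  have h3 := le_of_mul_le_mul_left h2 hκ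
  nlinarith

/-- The Hessian at a local maximum is negative semidefinite. -/
lemma IsLocalMax.fderiv_fderiv_apply_nonpos {E : Type*} [NormedAddCommGroup E] [NormedSpace ℝ E]
    {f : E → ℝ} {x : E} (hmax : IsLocalMax f x) (hf : ContDiffAt ℝ 2 f x) (v : E) :
    fderiv ℝ (fderiv ℝ f) x v v ≤ 0 := by
  by_contra! hpos
  set l : ℝ → E := fun s => x + s • v
  have hl0 : l 0 = x := by simp [l]
  have hl : ∀ s, HasDerivAt l v s := fun s => by
    simpa [l] using ((hasDerivAt_id s).smul_const v).const_add x
  have hlc : Filter.Tendsto l (nhds 0) (nhds x) := by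
    simpa [hl0] using (hl 0).continuousAt.tendsto
  have hdiff : ∀ᶠ y in nhds x, DifferentiableAt ℝ f y :=
    (hf.eventually (by simp)).mono fun y hy => hy.differentiableAt (by simp)
  have hderiv : deriv (f ∘ l) =ᶠ[nhds 0] fun s => fderiv ℝ f (l s) v := by
    filter_upwards [hlc.eventually hdiff] with s hs
    exact (hs.hasFDerivAt.comp_hasDerivAt s (hl s)).deriv
  have hD : HasFDerivAt (fderiv ℝ f) (fderiv ℝ (fderiv ℝ f) x) (l 0) := by
    rw [hl0]
    exact ((hf.fderiv_right (m := 1) (by norm_num)).differentiableAt (by simp)).hasFDerivAt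
  have hdd : deriv (deriv (f ∘ l)) 0 = fderiv ℝ (fderiv ℝ f) x v v := by
    rw [hderiv.deriv_eq]
    exact ((hD.comp_hasDerivAt 0 (hl 0)).clm_apply (hasDerivAt_const 0 v)).deriv.trans (by simp)
  have hmax' : IsLocalMax (f ∘ l) 0 := by
    have := hlc.eventually hmax
    simpa [IsLocalMax, IsMaxFilter, hl0] using this
  have hmin : IsLocalMin (f ∘ l) 0 :=
    isLocalMin_of_deriv_deriv_pos (by rwa [hdd]) hmax'.deriv_eq_zero
      ((hl0 ▸ hf.continuousAt : ContinuousAt f (l 0)).comp (hl 0).continuousAt)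
  have hconst : (f ∘ l) =ᶠ[nhds 0] fun _ => (f ∘ l) 0 := by
    filter_upwards [hmax', hmin] with s h1 h2
    exact le_antisymm h1 h2
  have h1 : deriv (f ∘ l) =ᶠ[nhds 0] fun _ => 0 := by
    simpa using hconst.deriv
  have h2 : deriv (deriv (f ∘ l)) 0 = 0 := by
    rw [h1.deriv_eq]; simp
  linarith [hdd ▸ h2]


lemma dotProduct_sub_neg_of_isOpen {n : ℕ} {Ω : Set (Fin n → ℝ)} (hΩo : IsOpen Ω)
    {ν x : Fin n → ℝ} (hν : ν ≠ 0) (h : ∀ y ∈ Ω, ν ⬝ᵥ (y - x) ≤ 0) {y : Fin n → ℝ} (hy : y ∈ Ω) :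
    ν ⬝ᵥ (y - x) < 0 := by
  have ht : Filter.Tendsto (fun s : ℝ => y + s • ν) (nhdsWithin 0 (Ioi 0)) (nhds y) := by
    have : Continuous fun s : ℝ => y + s • ν := by fun_prop
    simpa using (this.tendsto 0).mono_left nhdsWithin_le_nhds
  obtain ⟨s, hs, hs0⟩ :=
    ((ht.eventually (hΩo.mem_nhds hy)).and self_mem_nhdsWithin).exists
  have h1 := h _ hs
  have h2 : 0 < ν ⬝ᵥ ν := by
    refine lt_of_le_of_ne (Finset.sum_nonneg fun i _ => mul_self_nonneg _) (Ne.symm ?_)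
    simpa [dotProduct_self_eq_zero] using hν
  have h3 : ν ⬝ᵥ (y + s • ν - x) = ν ⬝ᵥ (y - x) + s * (ν ⬝ᵥ ν) := by
    simp only [dotProduct_sub, dotProduct_add, dotProduct_smul, smul_eq_mul]; ring
  have h4 : 0 < s * (ν ⬝ᵥ ν) := mul_pos hs0 h2
  linarith

lemma dotProduct_sub_nonpos_closure {n : ℕ} {Ω : Set (Fin n → ℝ)}
    {ν x : Fin n → ℝ} (h : ∀ y ∈ Ω, ν ⬝ᵥ (y - x) ≤ 0) {y : Fin n → ℝ} (hy : y ∈ closure Ω) :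
    ν ⬝ᵥ (y - x) ≤ 0 :=
  le_on_closure (f := fun y => ν ⬝ᵥ (y - x)) h
    (by fun_prop) continuousOn_const hy

/-- If a convex open set has a continuous nonvanishing field of outward normals, then its normal
cones are rays. -/
lemma exists_eq_smul_of_outward_normal {n : ℕ} {Ω : Set (Fin n → ℝ)} (hΩo : IsOpen Ω)
    (hΩconv : Convex ℝ Ω) (hΩne : Ω.Nonempty) {γ : (Fin n → ℝ) → Fin n → ℝ}
    (hγ0 : ∀ x ∈ frontier Ω, γ x ≠ 0)
    (hγout : ∀ x ∈ frontier Ω, ∀ y ∈ Ω, γ x ⬝ᵥ (y - x) ≤ 0)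
    (hγc : ContinuousOn γ (frontier Ω)) {x : Fin n → ℝ} (hx : x ∈ frontier Ω)
    {ν : Fin n → ℝ} (hν : ∀ y ∈ Ω, ν ⬝ᵥ (y - x) ≤ 0) :
    ∃ c : ℝ, 0 ≤ c ∧ ν = c • γ x := by
  obtain ⟨o, ho⟩ := hΩne
  set S : Set (Fin n → ℝ) := (fun z => o + z) ⁻¹' Ω
  have hSconv : Convex ℝ S := hΩconv.translate_preimage_right o
  have hS0 : S ∈ nhds 0 :=
    (hΩo.preimage (continuous_const.add continuous_id)).mem_nhds (by simpa [S] using ho)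
  have hfr : ∀ z, z ∈ frontier S ↔ o + z ∈ frontier Ω := fun z => by
    have := (Homeomorph.addLeft o).preimage_frontier Ω
    exact (Set.ext_iff.1 this z).symm
  have hgc := continuous_gauge hSconv hS0
  set X := x - o
  have hX : gauge S X = 1 := (gauge_eq_one_iff_mem_frontier hSconv hS0).2 ((hfr X).2 (by simpa [X]))
  have hγX : 0 < γ x ⬝ᵥ X := by
    have := dotProduct_sub_neg_of_isOpen hΩo (hγ0 x hx) (hγout x hx) ho
    rw [← neg_sub, dotProduct_neg] at this
    linarith
  have hνX : 0 ≤ ν ⬝ᵥ X := by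
    have := hν o ho
    rw [← neg_sub, dotProduct_neg] at this
    linarith
  have hcone : ∀ ξ, (ν ⬝ᵥ ξ) * (γ x ⬝ᵥ X) ≤ (γ x ⬝ᵥ ξ) * (ν ⬝ᵥ X) := by
    intro ξ
    set r : ℝ → ℝ := fun s => gauge S (X + s • ξ)
    set z : ℝ → Fin n → ℝ := fun s => o + (r s)⁻¹ • (X + s • ξ)
    have hline : Continuous fun s : ℝ => X + s • ξ := by fun_prop
    have hr : Filter.Tendsto r (nhds 0) (nhds 1) := by
      have := (hgc.comp hline).tendsto 0
      simpa [r, hX, Function.comp_def] using this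
    have hz : Filter.Tendsto z (nhds 0) (nhds x) := by
      have := tendsto_const_nhds (x := o) |>.add ((hr.inv₀ one_ne_zero).smul (hline.tendsto 0))
      simpa [z, X] using this
    have hrpos : ∀ᶠ s in nhds (0 : ℝ), 0 < r s := hr.eventually (lt_mem_nhds one_pos)
    have hzfr : ∀ᶠ s in nhds (0 : ℝ), z s ∈ frontier Ω := by
      filter_upwards [hrpos] with s hs
      refine (hfr _).1 ((gauge_eq_one_iff_mem_frontier hSconv hS0).1 ?_)
      rw [gauge_smul_of_nonneg (inv_nonneg.2 hs.le), smul_eq_mul]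
      exact inv_mul_cancel₀ hs.ne'
    have hγz : Filter.Tendsto (fun s => γ (z s)) (nhds 0) (nhds (γ x)) :=
      (hγc x hx).tendsto.comp (tendsto_nhdsWithin_iff.2 ⟨hz, hzfr⟩)
    have hγXs : ∀ᶠ s in nhds (0 : ℝ), 0 < γ (z s) ⬝ᵥ X := by
      have h1 : Continuous fun w : Fin n → ℝ => w ⬝ᵥ X := by fun_prop
      exact ((h1.tendsto _).comp hγz).eventually (lt_mem_nhds hγX)
    have hlim : Filter.Tendsto (fun s => (γ (z s) ⬝ᵥ ξ) * (ν ⬝ᵥ X)) (nhdsWithin 0 (Ioi 0))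
        (nhds ((γ x ⬝ᵥ ξ) * (ν ⬝ᵥ X))) := by
      have h1 : Continuous fun w : Fin n → ℝ => (w ⬝ᵥ ξ) * (ν ⬝ᵥ X) := by fun_prop
      exact ((h1.tendsto _).comp hγz).mono_left nhdsWithin_le_nhds
    have hlim' : Filter.Tendsto (fun s => (ν ⬝ᵥ ξ) * (γ (z s) ⬝ᵥ X)) (nhdsWithin 0 (Ioi 0))
        (nhds ((ν ⬝ᵥ ξ) * (γ x ⬝ᵥ X))) := by
      have h1 : Continuous fun w : Fin n → ℝ => (ν ⬝ᵥ ξ) * (w ⬝ᵥ X) := by fun_prop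
      exact ((h1.tendsto _).comp hγz).mono_left nhdsWithin_le_nhds
    refine le_of_tendsto_of_tendsto hlim' hlim ?_
    filter_upwards [nhdsWithin_le_nhds hrpos, nhdsWithin_le_nhds hzfr, self_mem_nhdsWithin,
      nhdsWithin_le_nhds hγXs] with s hs hzs hs0 b2
    have hs0 : 0 < s := hs0
    have e1 : r s • (z s - o) = X + s • ξ := by simp [z, smul_smul, hs.ne']
    have a1 : ν ⬝ᵥ (z s - x) ≤ 0 := dotProduct_sub_nonpos_closure hν (frontier_subset_closure hzs)
    have a2 : γ (z s) ⬝ᵥ (x - z s) ≤ 0 :=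
      dotProduct_sub_nonpos_closure (hγout _ hzs) (frontier_subset_closure hx)
    have c1 : ν ⬝ᵥ X + s * (ν ⬝ᵥ ξ) ≤ r s * (ν ⬝ᵥ X) := by
      have h3 : r s * (ν ⬝ᵥ (z s - o)) = ν ⬝ᵥ X + s * (ν ⬝ᵥ ξ) := by
        rw [← smul_eq_mul, ← dotProduct_smul, e1]; simp
      have h2 : ν ⬝ᵥ (z s - o) = ν ⬝ᵥ (z s - x) + ν ⬝ᵥ X := by
        rw [← dotProduct_add]; congr 1; simp [X]
      nlinarith
    have c2 : r s * (γ (z s) ⬝ᵥ X) ≤ γ (z s) ⬝ᵥ X + s * (γ (z s) ⬝ᵥ ξ) := by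
      have h3 : r s * (γ (z s) ⬝ᵥ (z s - o)) = γ (z s) ⬝ᵥ X + s * (γ (z s) ⬝ᵥ ξ) := by
        rw [← smul_eq_mul, ← dotProduct_smul, e1]; simp
      have h2 : γ (z s) ⬝ᵥ (z s - o) = γ (z s) ⬝ᵥ X - γ (z s) ⬝ᵥ (x - z s) := by
        rw [← dotProduct_sub]; congr 1; simp [X]
      nlinarith
    refine le_of_mul_le_mul_left ?_ hs0
    nlinarith [mul_le_mul_of_nonneg_right c1 b2.le, mul_le_mul_of_nonneg_right c2 hνX]
  refine ⟨(ν ⬝ᵥ X) / (γ x ⬝ᵥ X), by positivity, ?_⟩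
  have heq : ∀ ξ, ν ⬝ᵥ ξ = (((ν ⬝ᵥ X) / (γ x ⬝ᵥ X)) • γ x) ⬝ᵥ ξ := fun ξ => by
    have h1 := hcone ξ
    have h2 := hcone (-ξ)
    simp only [dotProduct_neg] at h2
    rw [smul_dotProduct, smul_eq_mul, div_mul_eq_mul_div, eq_div_iff hγX.ne']
    linarith
  exact dotProduct_eq _ _ heq

/-- A smooth nonnegative function whose gradient on the boundary is almost parallel to the
outward normal. -/
lemma exists_boundary_barrier {n : ℕ} {Ω : Set (Fin n → ℝ)} (hΩo : IsOpen Ω)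
    (hΩconv : Convex ℝ Ω) (hΩbd : Bornology.IsBounded Ω) (hΩne : Ω.Nonempty)
    {γ : (Fin n → ℝ) → Fin n → ℝ} (hγunit : ∀ x ∈ frontier Ω, ‖WithLp.toLp 2 (γ x)‖ = 1)
    (hγout : ∀ x ∈ frontier Ω, ∀ y ∈ Ω, γ x ⬝ᵥ (y - x) ≤ 0)
    (hγc : ContinuousOn γ (frontier Ω)) {δ : ℝ} (hδ : 0 < δ) :
    ∃ φ : (Fin n → ℝ) → ℝ, ContDiff ℝ (⊤ : ℕ∞) φ ∧ (∀ x, 0 ≤ φ x) ∧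
      ∀ x ∈ frontier Ω, ∃ (μ : ℝ) (e : Fin n → ℝ), 0 < μ ∧ ‖WithLp.toLp 2 e‖ ≤ δ ∧
        ∀ v, fderiv ℝ φ x v = μ * ((γ x + e) ⬝ᵥ v) := by
  have hγ0 : ∀ x ∈ frontier Ω, γ x ≠ 0 := fun x hx h0 => by
    have := hγunit x hx
    simp [h0] at this
  have hcpt : IsCompact (frontier Ω) :=
    hΩbd.isCompact_closure.of_isClosed_subset isClosed_frontier frontier_subset_closure
  set ℓ : (Fin n → ℝ) → (Fin n → ℝ) → ℝ := fun y x => γ y ⬝ᵥ (x - y)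
  have hℓ : ContinuousOn (fun q : (Fin n → ℝ) × (Fin n → ℝ) => ℓ q.1 q.2)
      (frontier Ω ×ˢ frontier Ω) := by
    have h1 : ContinuousOn (fun q : (Fin n → ℝ) × (Fin n → ℝ) => γ q.1)
        (frontier Ω ×ˢ frontier Ω) := hγc.comp continuousOn_fst fun q hq => hq.1
    have h2 : Continuous fun p : (Fin n → ℝ) × (Fin n → ℝ) => p.1 ⬝ᵥ p.2 := by fun_prop
    exact h2.comp_continuousOn (h1.prodMk (by fun_prop))
  set d : (Fin n → ℝ) → (Fin n → ℝ) → ℝ := fun y x => ‖WithLp.toLp 2 (γ y - γ x)‖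
  have hd : ContinuousOn (fun q : (Fin n → ℝ) × (Fin n → ℝ) => d q.1 q.2)
      (frontier Ω ×ˢ frontier Ω) := by
    have h1 : ContinuousOn (fun q : (Fin n → ℝ) × (Fin n → ℝ) => γ q.1)
        (frontier Ω ×ˢ frontier Ω) := hγc.comp continuousOn_fst fun q hq => hq.1
    have h2 : ContinuousOn (fun q : (Fin n → ℝ) × (Fin n → ℝ) => γ q.2)
        (frontier Ω ×ˢ frontier Ω) := hγc.comp continuousOn_snd fun q hq => hq.2
    exact ((PiLp.continuous_toLp 2 _).comp_continuousOn (h1.sub h2)).norm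
  have hd2 : ∀ y ∈ frontier Ω, ∀ x ∈ frontier Ω, d y x ≤ 2 := fun y hy x hx => by
    have := norm_sub_le (WithLp.toLp 2 (γ y)) (WithLp.toLp 2 (γ x))
    rw [hγunit y hy, hγunit x hx] at this
    simp only [d, WithLp.toLp_sub]
    linarith
  obtain ⟨c, hc, hbad⟩ : ∃ c > 0, ∀ y ∈ frontier Ω, ∀ x ∈ frontier Ω, δ / 2 ≤ d y x →
      ℓ y x ≤ -(2 * c) := by
    set B := (frontier Ω ×ˢ frontier Ω) ∩ (fun q => d q.1 q.2) ⁻¹' Ici (δ / 2)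
    have hB : IsCompact B := (hcpt.prod hcpt).of_isClosed_subset
      (hd.preimage_isClosed_of_isClosed (isClosed_frontier.prod isClosed_frontier) isClosed_Ici)
      inter_subset_left
    rcases B.eq_empty_or_nonempty with hBe | hBne
    · refine ⟨1, one_pos, fun y hy x hx h => ?_⟩
      have : (y, x) ∈ B := ⟨⟨hy, hx⟩, h⟩
      simp [hBe] at this
    · obtain ⟨⟨y₀, x₀⟩, hq, hmax⟩ := hB.exists_isMaxOn hBne (hℓ.mono inter_subset_left)
      have hy₀ : y₀ ∈ frontier Ω := hq.1.1
      have hx₀ : x₀ ∈ frontier Ω := hq.1.2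
      have hdq : δ / 2 ≤ d y₀ x₀ := hq.2
      have hneg : ℓ y₀ x₀ < 0 := by
        refine lt_of_le_of_ne (dotProduct_sub_nonpos_closure (hγout y₀ hy₀)
          (frontier_subset_closure hx₀)) fun h0 => ?_
        obtain ⟨a, ha, hae⟩ := exists_eq_smul_of_outward_normal hΩo hΩconv hΩne hγ0 hγout hγc hx₀
          (ν := γ y₀) fun z hz => by
            have h1 := hγout y₀ hy₀ z hz
            have h2 : γ y₀ ⬝ᵥ (z - x₀) = γ y₀ ⬝ᵥ (z - y₀) - ℓ y₀ x₀ := by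
              simp only [ℓ]; rw [← dotProduct_sub]; congr 1; simp
            linarith
        have ha1 : a = 1 := by
          have := hγunit y₀ hy₀
          rw [hae, WithLp.toLp_smul, norm_smul, hγunit x₀ hx₀, Real.norm_eq_abs,
            abs_of_nonneg ha] at this
          linarith
        have : d y₀ x₀ = 0 := by simp [d, hae, ha1]
        linarith
      refine ⟨-ℓ y₀ x₀ / 2, by linarith, fun y hy x hx h => ?_⟩
      have := hmax (show (y, x) ∈ B from ⟨⟨hy, hx⟩, h⟩)
      simp only [Set.mem_ofPred_eq] at this
      linarith
  obtain ⟨s, hsfr, hscov⟩ := hcpt.elim_nhds_subcover (fun y => {x | -c < ℓ y x}) fun y _ => by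
    have h1 : Continuous fun x => ℓ y x := by fun_prop
    exact (isOpen_lt continuous_const h1).mem_nhds (by simpa [ℓ] using hc)
  set k : ℝ := (4 * s.card + 1) / (c * δ)
  have hk : 0 < k := by positivity
  have hkexp : 4 * s.card * Real.exp (-(2 * c * k)) ≤ δ * Real.exp (-(c * k)) := by
    have h1 : 4 * s.card ≤ δ * Real.exp (c * k) := by
      have h2 := Real.add_one_le_exp (c * k)
      have h3 : δ * (c * k) = 4 * s.card + 1 := by simp only [k]; field_simp
      nlinarith
    have h4 : Real.exp (-(c * k)) = Real.exp (c * k) * Real.exp (-(2 * c * k)) := by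
      rw [← Real.exp_add]; congr 1; ring
    rw [h4, ← mul_assoc]
    exact mul_le_mul_of_nonneg_right h1 (Real.exp_pos _).le
  have hℓd : ∀ y x, HasFDerivAt (fun x => ℓ y x)
      (LinearMap.toContinuousLinearMap (dotProductBilin ℝ ℝ (γ y))) x := fun y x => by
    have h1 := (LinearMap.toContinuousLinearMap (dotProductBilin ℝ ℝ (γ y))).hasFDerivAt (x := x)
    have h2 : (fun x => ℓ y x) = fun x =>
        LinearMap.toContinuousLinearMap (dotProductBilin ℝ ℝ (γ y)) x - γ y ⬝ᵥ y := by
      ext x; simp [ℓ, dotProduct_sub]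
    rw [h2]
    exact h1.sub_const _
  refine ⟨fun x => ∑ y ∈ s, Real.exp (k * ℓ y x), ?_,
    fun x => Finset.sum_nonneg fun y _ => (Real.exp_pos _).le, fun x hx => ?_⟩
  · refine ContDiff.sum fun y _ => Real.contDiff_exp.comp (contDiff_const.mul ?_)
    have h2 : ℓ y = fun x =>
        LinearMap.toContinuousLinearMap (dotProductBilin ℝ ℝ (γ y)) x - γ y ⬝ᵥ y := by
      ext x; simp [ℓ, dotProduct_sub]
    rw [h2]
    exact (ContinuousLinearMap.contDiff _).sub contDiff_const
  set w : (Fin n → ℝ) → ℝ := fun y => Real.exp (k * ℓ y x)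
  set W := ∑ y ∈ s, w y
  have hw : ∀ y, 0 < w y := fun y => Real.exp_pos _
  obtain ⟨y₁, hy₁, hy₁x⟩ : ∃ y ∈ s, -c < ℓ y x := by
    simpa using hscov hx
  have hWlow : Real.exp (-(c * k)) ≤ W := by
    refine le_trans ?_ (Finset.single_le_sum (fun y _ => (hw y).le) hy₁)
    exact Real.exp_le_exp.2 (by nlinarith)
  have hW : 0 < W := (Real.exp_pos _).trans_le hWlow
  refine ⟨k * W, W⁻¹ • ∑ y ∈ s, w y • (γ y - γ x), by positivity, ?_, fun v => ?_⟩
  · rw [WithLp.toLp_smul, WithLp.toLp_sum, norm_smul, Real.norm_eq_abs,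
      abs_of_pos (inv_pos.2 hW), inv_mul_le_iff₀ hW]
    have hterm : ∀ y ∈ s, ‖WithLp.toLp 2 (w y • (γ y - γ x))‖ ≤
        w y * (δ / 2) + 2 * Real.exp (-(2 * c * k)) := fun y hy => by
      rw [WithLp.toLp_smul, norm_smul, Real.norm_eq_abs, abs_of_pos (hw y)]
      change w y * d y x ≤ _
      rcases le_total (d y x) (δ / 2) with h | h
      · have := mul_le_mul_of_nonneg_left h (hw y).le
        have := Real.exp_pos (-(2 * c * k))
        linarith
      · have h1 : w y ≤ Real.exp (-(2 * c * k)) :=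
          Real.exp_le_exp.2 (by nlinarith [hbad y (hsfr y hy) x hx h])
        have h2 := mul_le_mul h1 (hd2 y (hsfr y hy) x hx) (norm_nonneg _) (Real.exp_pos _).le
        have := mul_pos (hw y) hδ
        linarith
    calc ‖∑ y ∈ s, WithLp.toLp 2 (w y • (γ y - γ x))‖
        ≤ ∑ y ∈ s, (w y * (δ / 2) + 2 * Real.exp (-(2 * c * k))) :=
          norm_sum_le_of_le _ hterm
      _ = W * (δ / 2) + s.card * (2 * Real.exp (-(2 * c * k))) := by
          rw [Finset.sum_add_distrib, ← Finset.sum_mul]; simp [W]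
      _ ≤ W * δ := by nlinarith
  · have hder : HasFDerivAt (fun x => ∑ y ∈ s, Real.exp (k * ℓ y x))
        (∑ y ∈ s, w y • k • LinearMap.toContinuousLinearMap (dotProductBilin ℝ ℝ (γ y))) x :=
      HasFDerivAt.fun_sum fun y _ => ((hℓd y x).const_mul k).exp
    have hcomb : γ x + W⁻¹ • ∑ y ∈ s, w y • (γ y - γ x) = W⁻¹ • ∑ y ∈ s, w y • γ y := by
      simp only [smul_sub, Finset.sum_sub_distrib, ← Finset.sum_smul]
      rw [show (∑ y ∈ s, w y) = W from rfl, inv_smul_smul₀ hW.ne']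
      abel
    rw [hder.fderiv, hcomb, smul_dotProduct, sum_dotProduct]
    simp only [sum_apply, smul_apply, smul_dotProduct,
      smul_eq_mul, LinearMap.coe_toContinuousLinearMap', dotProductBilin_apply_apply]
    rw [mul_assoc, mul_inv_cancel_left₀ hW.ne', Finset.mul_sum]
    exact Finset.sum_congr rfl fun y _ => by ring

/-- The mean curvature operator `Σ Bᵢᵢ + B(p, p) / (1 - |p|²)` as a function of a gradient `P`,
with coordinate vector `p`, and a Hessian `B`. -/
def mcOp {n : ℕ} (P : (Fin n → ℝ) →L[ℝ] ℝ) (B : (Fin n → ℝ) →L[ℝ] (Fin n → ℝ) →L[ℝ] ℝ) : ℝ :=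
  ∑ i, B (Pi.single i 1) (Pi.single i 1) +
    B (fun i => P (Pi.single i 1)) (fun i => P (Pi.single i 1)) /
      (1 - ∑ i, P (Pi.single i 1) ^ 2)

lemma ContinuousLinearMap.apply_eq_dotProduct {n : ℕ} (P : (Fin n → ℝ) →L[ℝ] ℝ)
    (v : Fin n → ℝ) : P v = (fun i => P (Pi.single i 1)) ⬝ᵥ v := by
  conv_lhs => rw [pi_eq_sum_univ' v]
  simp [dotProduct, mul_comm]

lemma mcOp_le_mcOp {n : ℕ} {P : (Fin n → ℝ) →L[ℝ] ℝ}
    {A B : (Fin n → ℝ) →L[ℝ] (Fin n → ℝ) →L[ℝ] ℝ} (hP : ∑ i, P (Pi.single i 1) ^ 2 < 1)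
    (hAB : ∀ v, A v v ≤ B v v) : mcOp P A ≤ mcOp P B := by
  unfold mcOp
  have := sub_pos.2 hP
  gcongr
  · exact hAB _
  · exact hAB _

lemma continuousAt_mcOp {n : ℕ}
    {q : ((Fin n → ℝ) →L[ℝ] ℝ) × ((Fin n → ℝ) →L[ℝ] (Fin n → ℝ) →L[ℝ] ℝ)}
    (hq : ∑ i, q.1 (Pi.single i 1) ^ 2 < 1) :
    ContinuousAt (fun r : ((Fin n → ℝ) →L[ℝ] ℝ) × ((Fin n → ℝ) →L[ℝ] (Fin n → ℝ) →L[ℝ] ℝ) =>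
      mcOp r.1 r.2) q := by
  unfold mcOp
  have h := (sub_pos.2 hq).ne'
  refine ContinuousAt.add (by fun_prop) (ContinuousAt.div ?_ (by fun_prop) h)
  refine Continuous.continuousAt ?_
  fun_prop

lemma fderivWithin_fderivWithin_of_mem_nhds {E F : Type*} [NormedAddCommGroup E] [NormedSpace ℝ E]
    [NormedAddCommGroup F] [NormedSpace ℝ F] {f : E → F} {K : Set E} {x : E} (hK : K ∈ nhds x) :
    fderivWithin ℝ (fderivWithin ℝ f K) K x = fderiv ℝ (fderiv ℝ f) x := by
  rw [fderivWithin_of_mem_nhds hK]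
  refine Filter.EventuallyEq.fderiv_eq ?_
  filter_upwards [eventually_mem_nhds_iff.2 hK] with y hy
  exact fderivWithin_of_mem_nhds hy

/-- The divergence form of the mean curvature operator, expanded. -/
lemma sqrt_mul_divergence_eq_mcOp {n : ℕ} {f : (Fin n → ℝ) → ℝ} {K : Set (Fin n → ℝ)}
    {x : Fin n → ℝ} (hK : K ∈ nhds x) (hf : ContDiffAt ℝ 2 f x)
    (hx : ∑ i, fderiv ℝ f x (Pi.single i 1) ^ 2 < 1) :
    Real.sqrt (1 - ∑ i, fderivWithin ℝ f K x (Pi.single i 1) ^ 2) *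
      ∑ i, fderivWithin ℝ (fun y => fderivWithin ℝ f K y (Pi.single i 1) /
        Real.sqrt (1 - ∑ j, fderivWithin ℝ f K y (Pi.single j 1) ^ 2)) K x (Pi.single i 1) =
      mcOp (fderiv ℝ f x) (fderiv ℝ (fderiv ℝ f) x) := by
  have hD : HasFDerivAt (fderiv ℝ f) (fderiv ℝ (fderiv ℝ f) x) x :=
    ((hf.fderiv_right (m := 1) (by norm_num)).differentiableAt (by simp)).hasFDerivAt
  set A := fderiv ℝ (fderiv ℝ f) x
  set p : Fin n → ℝ := fun i => fderiv ℝ f x (Pi.single i 1)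
  set σ := 1 - ∑ i, p i ^ 2
  have hσ : 0 < σ := sub_pos.2 hx
  set v := Real.sqrt σ
  have hv : 0 < v := Real.sqrt_pos.2 hσ
  have hv2 : v ^ 2 = σ := Real.sq_sqrt hσ.le
  have hterm : ∀ i, fderivWithin ℝ (fun y => fderivWithin ℝ f K y (Pi.single i 1) /
        Real.sqrt (1 - ∑ j, fderivWithin ℝ f K y (Pi.single j 1) ^ 2)) K x (Pi.single i 1) =
      A (Pi.single i 1) (Pi.single i 1) / v +
        p i * (∑ j, p j * A (Pi.single i 1) (Pi.single j 1)) / v ^ 3 := by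
    intro i
    set G : (Fin n → ℝ) → ℝ := fun y => fderiv ℝ f y (Pi.single i 1) /
        Real.sqrt (1 - ∑ j, fderiv ℝ f y (Pi.single j 1) ^ 2)
    have hcongr : (fun y => fderivWithin ℝ f K y (Pi.single i 1) /
        Real.sqrt (1 - ∑ j, fderivWithin ℝ f K y (Pi.single j 1) ^ 2)) =ᶠ[nhds x] G := by
      filter_upwards [eventually_mem_nhds_iff.2 hK] with y hy
      simp only [G, fderivWithin_of_mem_nhds hy]
    rw [fderivWithin_of_mem_nhds hK, hcongr.fderiv_eq]
    have hg : ∀ j, DifferentiableAt ℝ (fun y => fderiv ℝ f y (Pi.single j 1)) x := fun j =>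
      hD.differentiableAt.clm_apply (differentiableAt_const _)
    have hGd : DifferentiableAt ℝ G x := by
      have hs : DifferentiableAt ℝ (fun y => 1 - ∑ j, fderiv ℝ f y (Pi.single j 1) ^ 2) x :=
        (DifferentiableAt.fun_sum fun j _ => (hg j).fun_pow 2).const_sub 1
      simpa only [G, div_eq_mul_inv] using (hg i).fun_mul ((hs.sqrt hσ.ne').fun_inv hv.ne')
    set l : ℝ → Fin n → ℝ := fun s => x + s • Pi.single i 1
    have hl0 : l 0 = x := by simp [l]
    have hl : HasDerivAt l (Pi.single i 1) 0 := by
      simpa [l] using ((hasDerivAt_id (0 : ℝ)).smul_const (Pi.single i (1 : ℝ))).const_add x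
    have hgl : ∀ j, HasDerivAt (fun s => fderiv ℝ f (l s) (Pi.single j 1))
        (A (Pi.single i 1) (Pi.single j 1)) 0 := fun j => by
      have h1 := (hl0.symm ▸ hD : HasFDerivAt (fderiv ℝ f) A (l 0)).comp_hasDerivAt 0 hl
      simpa using h1.clm_apply (hasDerivAt_const 0 (Pi.single j (1 : ℝ)))
    have hσl : HasDerivAt (fun s => 1 - ∑ j, fderiv ℝ f (l s) (Pi.single j 1) ^ 2)
        (-∑ j, 2 * p j * A (Pi.single i 1) (Pi.single j 1)) 0 := by
      refine (HasDerivAt.fun_sum fun j _ => ?_).const_sub 1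
      simpa [hl0, p] using (hgl j).fun_pow 2
    have hGl : HasDerivAt (G ∘ l) _ 0 := (hgl i).div (hσl.sqrt (by simpa [hl0] using hσ.ne'))
      (by simpa [hl0] using hv.ne')
    have hGl' := (hl0.symm ▸ hGd.hasFDerivAt :
      HasFDerivAt G (fderiv ℝ G x) (l 0)).comp_hasDerivAt 0 hl
    rw [hGl'.unique hGl, hl0]
    change (_ * v - p i * (_ / (2 * v))) / v ^ 2 = _
    simp only [mul_assoc, ← Finset.mul_sum]
    field_simp
    ring
  have hquad : A p p = ∑ i, p i * ∑ j, p j * A (Pi.single i 1) (Pi.single j 1) := by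
    have h1 : A p p = (A.flip p) p := rfl
    rw [h1, (A.flip p).apply_eq_dotProduct, dotProduct]
    refine Finset.sum_congr rfl fun i _ => ?_
    rw [mul_comm, ContinuousLinearMap.flip_apply, (A (Pi.single i 1)).apply_eq_dotProduct,
      dotProduct_comm]
    rfl
  have hσ' : 1 - ∑ i, fderivWithin ℝ f K x (Pi.single i 1) ^ 2 = σ := by
    rw [fderivWithin_of_mem_nhds hK]
  rw [hσ', Finset.sum_congr rfl fun i _ => hterm i, Finset.sum_add_distrib, ← Finset.sum_div,
    ← Finset.sum_div, ← hquad]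
  change v * _ = _ + A p p / σ
  rw [← hv2]
  field_simp

/-- Comparison of the mean curvature operators at a local maximum of `f - f₀ - ε φ`. -/
lemma mcOp_le_of_isLocalMax {n : ℕ} {f f₀ φ : (Fin n → ℝ) → ℝ} {x : Fin n → ℝ} {ε : ℝ}
    (hf : ContDiffAt ℝ 2 f x) (hf₀ : ContDiffAt ℝ 2 f₀ x) (hφ : ContDiffAt ℝ 2 φ x)
    (hmax : IsLocalMax (fun y => f y - f₀ y - ε * φ y) x)
    (hx : ∑ i, fderiv ℝ f x (Pi.single i 1) ^ 2 < 1) :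
    mcOp (fderiv ℝ f x) (fderiv ℝ (fderiv ℝ f) x) ≤
      mcOp (fderiv ℝ f₀ x + ε • fderiv ℝ φ x)
        (fderiv ℝ (fderiv ℝ f₀) x + ε • fderiv ℝ (fderiv ℝ φ) x) := by
  have hsmooth : fderiv ℝ (fun y => f y - f₀ y - ε * φ y) =ᶠ[nhds x] fun y =>
      fderiv ℝ f y - fderiv ℝ f₀ y - ε • fderiv ℝ φ y := by
    filter_upwards [hf.eventually (by simp), hf₀.eventually (by simp), hφ.eventually (by simp)]
      with y h1 h2 h3
    exact (((h1.differentiableAt (by simp)).hasFDerivAt.fun_sub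
      (h2.differentiableAt (by simp)).hasFDerivAt).fun_sub
      ((h3.differentiableAt (by simp)).hasFDerivAt.const_mul ε)).fderiv
  have hfirst : fderiv ℝ f x = fderiv ℝ f₀ x + ε • fderiv ℝ φ x := by
    have h1 := hsmooth.self_of_nhds
    simp only [hmax.fderiv_eq_zero] at h1
    rw [← sub_eq_zero, h1, sub_sub]
  rw [← hfirst]
  refine mcOp_le_mcOp hx fun v => ?_
  have h1 := hmax.fderiv_fderiv_apply_nonpos ((hf.sub hf₀).sub (contDiffAt_const.mul hφ)) v
  have hD : ∀ {g : (Fin n → ℝ) → ℝ}, ContDiffAt ℝ 2 g x →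
      HasFDerivAt (fderiv ℝ g) (fderiv ℝ (fderiv ℝ g) x) x := fun hg =>
    ((hg.fderiv_right (m := 1) (by norm_num)).differentiableAt (by simp)).hasFDerivAt
  rw [hsmooth.fderiv_eq, (((hD hf).fun_sub (hD hf₀)).fun_sub ((hD hφ).fun_const_smul ε)).fderiv] at h1
  simp only [sub_apply, smul_apply, add_apply] at h1 ⊢
  linarith

lemma continuousWithinAt_add_smul {E F : Type*} [TopologicalSpace E] [AddCommGroup F]
    [TopologicalSpace F] [IsTopologicalAddGroup F] [Module ℝ F] [ContinuousSMul ℝ F]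
    {K : Set E} {p g : E → F} {y : E} (hp : ContinuousWithinAt p K y) (hg : Continuous g) :
    ContinuousWithinAt (fun z : ℝ × E => p z.2 + z.1 • g z.2) (univ ×ˢ K) (0, y) :=
  (hp.comp (x := ((0 : ℝ), y)) continuousWithinAt_snd fun _ hz => hz.2).add
    (continuous_fst.smul (hg.comp continuous_snd)).continuousWithinAt

lemma ContinuousAt.comp_derivatives_add_smul {E : Type*} [NormedAddCommGroup E]
    [NormedSpace ℝ E] {G : (E →L[ℝ] ℝ) → (E →L[ℝ] E →L[ℝ] ℝ) → ℝ} {K : Set E} {f₀ φ : E → ℝ}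
    (hK : UniqueDiffOn ℝ K) (hf₀ : ContDiffOn ℝ 2 f₀ K) (hφ : ContDiff ℝ 2 φ) {y : E} (hy : y ∈ K)
    (hG : ContinuousAt (fun q : (E →L[ℝ] ℝ) × (E →L[ℝ] E →L[ℝ] ℝ) => G q.1 q.2)
      (fderivWithin ℝ f₀ K y, fderivWithin ℝ (fderivWithin ℝ f₀ K) K y)) :
    ContinuousWithinAt (fun z : ℝ × E =>
      G (fderivWithin ℝ f₀ K z.2 + z.1 • fderiv ℝ φ z.2)
        (fderivWithin ℝ (fderivWithin ℝ f₀ K) K z.2 + z.1 • fderiv ℝ (fderiv ℝ φ) z.2))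
      (univ ×ˢ K) (0, y) := by
  have hP : ContDiffOn ℝ 1 (fderivWithin ℝ f₀ K) K := hf₀.fderivWithin hK (by norm_num)
  have hφ' : ContDiff ℝ 1 (fderiv ℝ φ) := hφ.fderiv_right (by norm_num)
  have h1 := continuousWithinAt_add_smul (hP.continuousOn y hy) hφ'.continuous
  have h2 := continuousWithinAt_add_smul (hP.continuousOn_fderivWithin hK le_rfl y hy)
    (hφ'.continuous_fderiv (by simp))
  refine ContinuousAt.comp_continuousWithinAt
    (g := fun q : (E →L[ℝ] ℝ) × (E →L[ℝ] E →L[ℝ] ℝ) => G q.1 q.2) ?_ (h1.prodMk h2)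
  simpa using hG

lemma continuousWithinAt_mcOp_perturbation {n : ℕ} {K : Set (Fin n → ℝ)}
    {f₀ φ : (Fin n → ℝ) → ℝ} (hK : UniqueDiffOn ℝ K) (hf₀ : ContDiffOn ℝ 2 f₀ K)
    (hφ : ContDiff ℝ 2 φ) {y : Fin n → ℝ} (hy : y ∈ K)
    (hS : ∑ i, fderivWithin ℝ f₀ K y (Pi.single i 1) ^ 2 < 1) :
    ContinuousWithinAt (fun z : ℝ × (Fin n → ℝ) =>
      mcOp (fderivWithin ℝ f₀ K z.2 + z.1 • fderiv ℝ φ z.2)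
        (fderivWithin ℝ (fderivWithin ℝ f₀ K) K z.2 + z.1 • fderiv ℝ (fderiv ℝ φ) z.2))
      (univ ×ˢ K) (0, y) :=
  ContinuousAt.comp_derivatives_add_smul (G := mcOp) hK hf₀ hφ hy (continuousAt_mcOp hS)

section Flow

variable {n : ℕ} {Ω : Set (Fin n → ℝ)} {γ : (Fin n → ℝ) → Fin n → ℝ} {α : (Fin n → ℝ) → ℝ}
  {T : ℝ} {u : (Fin n → ℝ) → ℝ → ℝ}

lemma IsGraphMCF.contDiffOn_slice {J : Set ℝ} (hu : IsGraphMCF Ω γ α J u) {t : ℝ} (ht : t ∈ J) :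
    ContDiffOn ℝ (⊤ : ℕ∞) (fun y => u y t) (closure Ω) :=
  hu.smooth.comp (f := fun y => (y, t)) (contDiff_id.prodMk contDiff_const).contDiffOn
    fun _ hy => mk_mem_prod hy ht

lemma IsGraphMCF.continuousOn_spGradSq {J : Set ℝ} (hu : IsGraphMCF Ω γ α J u)
    (hK : UniqueDiffOn ℝ (closure Ω)) (hJ : UniqueDiffOn ℝ J) :
    ContinuousOn (fun q : (Fin n → ℝ) × ℝ => spGradSq Ω u q.1 q.2) (closure Ω ×ˢ J) := by
  have hD := hu.smooth.continuousOn_fderivWithin (hK.prod hJ) (by simp)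
  have heq : ∀ q ∈ closure Ω ×ˢ J, ∀ i, spGrad Ω u q.1 q.2 i =
      fderivWithin ℝ (fun q : (Fin n → ℝ) × ℝ => u q.1 q.2) (closure Ω ×ˢ J) q
        (Pi.single i 1, 0) := by
    rintro ⟨x, t⟩ hq i
    have h1 := (hu.smooth.differentiableOn (by simp) (x, t) hq).hasFDerivWithinAt
    have h2 : HasFDerivWithinAt (fun y : Fin n → ℝ => (y, t))
        (ContinuousLinearMap.inl ℝ (Fin n → ℝ) ℝ) (closure Ω) x :=
      (hasFDerivAt_prodMk_left x t).hasFDerivWithinAt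
    have h3 := h1.comp x h2 fun y hy => mk_mem_prod hy hq.2
    have h4 := h3.fderivWithin (hK x hq.1)
    simp only [Function.comp_def] at h4
    simp [spGrad, h4]
  refine ContinuousOn.congr (f := fun q => ∑ i, (fderivWithin ℝ
    (fun q : (Fin n → ℝ) × ℝ => u q.1 q.2) (closure Ω ×ˢ J) q (Pi.single i 1, 0)) ^ 2)
    (by fun_prop) fun q hq => ?_
  simp only [spGradSq, heq q hq]

lemma IsGraphMCF.neg {J : Set ℝ} (hu : IsGraphMCF Ω γ α J u)
    (hK : UniqueDiffOn ℝ (closure Ω)) :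
    IsGraphMCF Ω γ (fun x => -α x) J (fun x t => -u x t) := by
  have hg : ∀ x ∈ closure Ω, ∀ t i, spGrad Ω (fun x t => -u x t) x t i = -spGrad Ω u x t i := by
    intro x hx t i
    simp only [spGrad]
    rw [fderivWithin_fun_neg (hK x hx)]
    rfl
  have hS : ∀ x ∈ closure Ω, ∀ t, spGradSq Ω (fun x t => -u x t) x t = spGradSq Ω u x t := by
    intro x hx t
    simp only [spGradSq, hg x hx, neg_sq]
  refine ⟨hu.smooth.neg, fun x hx t ht => (hS x hx t).symm ▸ hu.spacelike x hx t ht,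
    fun x hx t ht => ?_, fun x hx t ht => ?_⟩
  · have hxK := subset_closure hx
    rw [derivWithin.fun_neg, hu.pde x hx t ht, hS x hxK, ← mul_neg, ← Finset.sum_neg_distrib]
    congr 1
    refine Finset.sum_congr rfl fun i _ => ?_
    rw [← neg_apply, ← fderivWithin_fun_neg (hK x hxK)]
    congr 1
    refine (fderivWithin_congr (fun y hy => ?_) ?_).symm
    · rw [hg y hy, hS y hy, neg_div]
    · rw [hg x hxK, hS x hxK, neg_div]
  · have hxK := frontier_subset_closure hx
    simp only [hg x hxK, hS x hxK, mul_neg, Finset.sum_neg_distrib, hu.neumann x hx t ht, neg_mul]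

lemma IsGraphMCF.derivWithin_eq_mcOp {J : Set ℝ} (hu : IsGraphMCF Ω γ α J u) (hΩo : IsOpen Ω)
    {x : Fin n → ℝ} (hx : x ∈ Ω) {t : ℝ} (ht : t ∈ J) :
    derivWithin (fun s => u x s) J t =
      mcOp (fderiv ℝ (fun y => u y t) x) (fderiv ℝ (fderiv ℝ (fun y => u y t)) x) := by
  have hK : closure Ω ∈ nhds x := Filter.mem_of_superset (hΩo.mem_nhds hx) subset_closure
  have hS := hu.spacelike x (subset_closure hx) t ht
  simp only [spGradSq, spGrad, fderivWithin_of_mem_nhds hK] at hS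
  rw [hu.pde x hx t ht]
  exact sqrt_mul_divergence_eq_mcOp hK
    (((hu.contDiffOn_slice ht).contDiffAt hK).of_le ENat.LEInfty.out) hS

/-- The time derivative is large at a point where `u - (C + η) t` is maximal over earlier times. -/
lemma IsGraphMCF.le_derivWithin_of_max (hu : IsGraphMCF Ω γ α (Ico 0 T) u) {x : Fin n → ℝ}
    (hx : x ∈ closure Ω) {a t : ℝ} (ht0 : 0 < t) (htT : t < T)
    (hmax : ∀ s ∈ Icc 0 t, u x s - a * s ≤ u x t - a * t) :
    a ≤ derivWithin (fun s => u x s) (Ico 0 T) t := by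
  have ht : t ∈ Ico 0 T := ⟨ht0.le, htT⟩
  have hslice : ContDiffOn ℝ (⊤ : ℕ∞) (fun s => u x s) (Ico 0 T) :=
    hu.smooth.comp (contDiff_const.prodMk contDiff_id).contDiffOn fun _ hs => ⟨hx, hs⟩
  have h1 := (hslice.differentiableOn (by simp) t ht).hasDerivWithinAt.mono
    (show Icc 0 t ⊆ Ico 0 T from fun s hs => ⟨hs.1, hs.2.trans_lt htT⟩)
  have h2 := h1.sub ((hasDerivWithinAt_id t (Icc 0 t)).const_mul a)
  have h3 : IsMaxOn (fun s => u x s - a * s) (Icc 0 t) t := fun s hs => hmax s hs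
  have h4 := h3.localize.hasFDerivWithinAt_nonpos h2.hasFDerivWithinAt
    (sub_mem_posTangentConeAt_of_segment_subset
      ((convex_Icc 0 t).segment_subset (right_mem_Icc.2 ht0.le) (left_mem_Icc.2 ht0.le)))
  simp at h4
  nlinarith

/-- A barrier whose gradient is almost normal to the boundary rules out boundary maxima of the
difference of two time slices. -/
lemma IsGraphMCF.not_isMaxOn_of_mem_frontier {J : Set ℝ} (hu : IsGraphMCF Ω γ α J u)
    (hΩo : IsOpen Ω) (hΩconv : Convex ℝ Ω) (hΩne : Ω.Nonempty)
    (hγunit : ∀ x ∈ frontier Ω, ‖WithLp.toLp 2 (γ x)‖ = 1)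
    (hγout : ∀ x ∈ frontier Ω, ∀ y ∈ Ω, γ x ⬝ᵥ (y - x) ≤ 0)
    (hγc : ContinuousOn γ (frontier Ω)) {x : Fin n → ℝ} (hxfr : x ∈ frontier Ω) {t s : ℝ}
    (ht : t ∈ J) (hs : s ∈ J) {c δ μ ε : ℝ} {e : Fin n → ℝ} {φ : (Fin n → ℝ) → ℝ} (hc : 0 < c)
    (hct : c ≤ Real.sqrt (1 - spGradSq Ω u x t)) (hcs : c ≤ Real.sqrt (1 - spGradSq Ω u x s))
    (hδ : δ * (1 + (c⁻¹ + (c ^ 3)⁻¹)) < 1) (hφ : DifferentiableAt ℝ φ x) (hμ : 0 < μ)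
    (he : ‖WithLp.toLp 2 e‖ ≤ δ) (hφx : ∀ v, fderiv ℝ φ x v = μ * ((γ x + e) ⬝ᵥ v))
    (hε : 0 < ε) : ¬ IsMaxOn (fun y => u y t - u y s - ε * φ y) (closure Ω) x := by
  intro hxmax
  have hx : x ∈ closure Ω := frontier_subset_closure hxfr
  have hγ0 : ∀ x ∈ frontier Ω, γ x ≠ 0 := fun x hx h0 => by
    have := hγunit x hx
    simp [h0] at this
  set P := fderivWithin ℝ (fun y => u y t) (closure Ω) x
  set Q := fderivWithin ℝ (fun y => u y s) (closure Ω) x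
  have hder : HasFDerivWithinAt (fun y => u y t - u y s - ε * φ y)
      (P - Q - ε • fderiv ℝ φ x) (closure Ω) x :=
    (((hu.contDiffOn_slice ht).differentiableOn (by simp) x hx).hasFDerivWithinAt.fun_sub
      ((hu.contDiffOn_slice hs).differentiableOn (by simp) x hx).hasFDerivWithinAt).fun_sub
      (hφ.hasFDerivAt.const_mul ε).hasFDerivWithinAt
  obtain ⟨a, ha, hae⟩ := exists_eq_smul_of_outward_normal hΩo hΩconv hΩne hγ0 hγout hγc hxfr
    (ν := fun i => (P - Q - ε • fderiv ℝ φ x) (Pi.single i 1)) fun y hy => by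
      rw [← ContinuousLinearMap.apply_eq_dotProduct]
      exact hxmax.localize.hasFDerivWithinAt_nonpos hder
        (sub_mem_posTangentConeAt_of_segment_subset
          (hΩconv.closure.segment_subset hx (subset_closure hy)))
  have hκ : 0 < a + ε * μ := by positivity
  have hnorm : ∀ r ∈ J, ‖WithLp.toLp 2 (spGrad Ω u x r)‖ ^ 2 =
      1 - Real.sqrt (1 - spGradSq Ω u x r) ^ 2 := fun r hr => by
    rw [Real.sq_sqrt (sub_nonneg.2 (hu.spacelike x hx r hr).le),
      EuclideanSpace.real_norm_sq_eq]
    simp [spGradSq]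
  have hinner : ∀ r ∈ J,
      inner ℝ (WithLp.toLp 2 (γ x)) (WithLp.toLp 2 (spGrad Ω u x r)) =
        α x * Real.sqrt (1 - spGradSq Ω u x r) := fun r hr => by
    rw [← hu.neumann x hxfr r hr]
    simp [PiLp.inner_apply, mul_comm]
  refine false_of_same_angle (e := WithLp.toLp 2 ((ε * μ / (a + ε * μ)) • e)) hc hct hcs
    (hnorm t ht) (hnorm s hs) (hγunit x hxfr) (hinner t ht) (hinner s hs) hκ ?_ hδ ?_
  · have h1 : ε * μ / (a + ε * μ) ≤ 1 := (div_le_one hκ).2 (by linarith)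
    have h2 : 0 ≤ ε * μ / (a + ε * μ) := by positivity
    rw [WithLp.toLp_smul, norm_smul, Real.norm_eq_abs, abs_of_nonneg h2]
    nlinarith [norm_nonneg (WithLp.toLp 2 e)]
  · rw [← WithLp.toLp_sub, ← WithLp.toLp_add, ← WithLp.toLp_smul]
    congr 1
    ext i
    have h1 := congrFun hae i
    have h2 : fderiv ℝ φ x (Pi.single i 1) = μ * (γ x i + e i) := by
      rw [hφx]; simp
    simp only [sub_apply, smul_apply, h2, Pi.smul_apply,
      smul_eq_mul] at h1
    change P (Pi.single i 1) - Q (Pi.single i 1) =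
      (a + ε * μ) * (γ x i + ε * μ / (a + ε * μ) * e i)
    field_simp
    linarith

/-- A solution with initial speed at most `C` stays below the supersolution `u(·,0) + C t`. -/
lemma IsGraphMCF.le_initial_add (hu : IsGraphMCF Ω γ α (Ico 0 T) u) (hΩo : IsOpen Ω)
    (hΩconv : Convex ℝ Ω) (hΩbd : Bornology.IsBounded Ω) (hΩne : Ω.Nonempty)
    (hγunit : ∀ x ∈ frontier Ω, ‖WithLp.toLp 2 (γ x)‖ = 1)
    (hγout : ∀ x ∈ frontier Ω, ∀ y ∈ Ω, γ x ⬝ᵥ (y - x) ≤ 0)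
    (hγc : ContinuousOn γ (frontier Ω)) {C : ℝ}
    (hC : ∀ x ∈ Ω, derivWithin (fun s => u x s) (Ico 0 T) 0 ≤ C)
    {x₁ : Fin n → ℝ} (hx₁ : x₁ ∈ closure Ω) {t₁ : ℝ} (ht₁ : t₁ ∈ Ico 0 T) :
    u x₁ t₁ ≤ u x₁ 0 + t₁ * C := by
  set K := closure Ω
  have hKc : IsCompact K := hΩbd.isCompact_closure
  have hKconv : Convex ℝ K := hΩconv.closure
  have hKu : UniqueDiffOn ℝ K := uniqueDiffOn_convex hKconv
    (hΩne.mono (interior_maximal subset_closure hΩo))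
  have hKnhds : ∀ x ∈ Ω, K ∈ nhds x := fun x hx =>
    Filter.mem_of_superset (hΩo.mem_nhds hx) subset_closure
  have h0T : (0 : ℝ) ∈ Ico 0 T := ⟨le_rfl, ht₁.1.trans_lt ht₁.2⟩
  have hIcc : Icc 0 t₁ ⊆ Ico 0 T := fun s hs => ⟨hs.1, hs.2.trans_lt ht₁.2⟩
  have hcyl : IsCompact (K ×ˢ Icc 0 t₁) := hKc.prod isCompact_Icc
  have hcyl_ne : (K ×ˢ Icc 0 t₁).Nonempty := ⟨(x₁, t₁), hx₁, right_mem_Icc.2 ht₁.1⟩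
  obtain ⟨c, hc, hcS⟩ : ∃ c > 0, ∀ x ∈ K, ∀ t ∈ Icc 0 t₁,
      c ≤ Real.sqrt (1 - spGradSq Ω u x t) := by
    obtain ⟨q, hq, hmax⟩ := hcyl.exists_isMaxOn hcyl_ne
      ((hu.continuousOn_spGradSq hKu (uniqueDiffOn_Ico 0 T)).mono (prod_mono_right hIcc))
    refine ⟨Real.sqrt (1 - spGradSq Ω u q.1 q.2),
      Real.sqrt_pos.2 (sub_pos.2 (hu.spacelike _ hq.1 _ (hIcc hq.2))), fun x hx t ht => ?_⟩
    have h1 : spGradSq Ω u x t ≤ spGradSq Ω u q.1 q.2 := hmax (show (x, t) ∈ _ from ⟨hx, ht⟩)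
    exact Real.sqrt_le_sqrt (by linarith)
  obtain ⟨δ, hδ, hδL⟩ : ∃ δ > 0, δ * (1 + (c⁻¹ + (c ^ 3)⁻¹)) < 1 := by
    refine ⟨(2 * (1 + (c⁻¹ + (c ^ 3)⁻¹)))⁻¹, by positivity, ?_⟩
    have : 0 < 1 + (c⁻¹ + (c ^ 3)⁻¹) := by positivity
    field_simp
    norm_num
  obtain ⟨φ, hφ, hφ0, hφγ⟩ :=
    exists_boundary_barrier hΩo hΩconv hΩbd hΩne hγunit hγout hγc hδ
  have hφ2 : ContDiff ℝ 2 φ := hφ.of_le ENat.LEInfty.out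
  set f₀ : (Fin n → ℝ) → ℝ := fun y => u y 0
  have hf₀ : ContDiffOn ℝ (⊤ : ℕ∞) f₀ K := hu.contDiffOn_slice h0T
  have hf₀2 : ContDiffOn ℝ 2 f₀ K := hf₀.of_le ENat.LEInfty.out
  set H : ℝ → (Fin n → ℝ) → ℝ := fun ε y =>
    mcOp (fderivWithin ℝ f₀ K y + ε • fderiv ℝ φ y)
      (fderivWithin ℝ (fderivWithin ℝ f₀ K) K y + ε • fderiv ℝ (fderiv ℝ φ) y)
  have hHc : ∀ y ∈ K, ContinuousWithinAt (fun z : ℝ × (Fin n → ℝ) => H z.1 z.2)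
      (univ ×ˢ K) (0, y) := by
    exact fun y hy => continuousWithinAt_mcOp_perturbation hKu hf₀2 hφ2 hy
      (hu.spacelike y hy 0 h0T)
  have hH0 : ∀ y ∈ K, H 0 y ≤ C := by
    have hcont : ContinuousOn (H 0) K := fun y hy =>
      (hHc y hy).comp (x := y) (f := fun y => ((0 : ℝ), y))
        (by fun_prop) fun z hz => ⟨mem_univ _, hz⟩
    refine le_on_closure (g := fun _ => C) (fun y hy => ?_) hcont continuousOn_const
    have := hC y hy
    rw [hu.derivWithin_eq_mcOp hΩo hy h0T] at this
    have hz : H 0 y = mcOp (fderiv ℝ f₀ y) (fderiv ℝ (fderiv ℝ f₀) y) := by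
      simp only [H]
      rw [fderivWithin_fderivWithin_of_mem_nhds (hKnhds y hy),
        fderivWithin_of_mem_nhds (hKnhds y hy)]
      exact congrArg₂ mcOp (by ext; simp) (by ext; simp)
    exact hz.trans_le this
  have hbarrier : ∀ η > 0, ∀ ε > 0, (∀ y ∈ K, H ε y < C + η) →
      ∀ x ∈ K, ∀ t ∈ Icc 0 t₁, u x t - u x 0 - (C + η) * t - ε * φ x ≤ 0 := by
    intro η hη ε hε hHε
    have hWc : ContinuousOn (fun q : (Fin n → ℝ) × ℝ =>
        u q.1 q.2 - u q.1 0 - (C + η) * q.2 - ε * φ q.1) (K ×ˢ Icc 0 t₁) := by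
      have h1 := hu.smooth.continuousOn.mono (prod_mono_right hIcc : K ×ˢ Icc 0 t₁ ⊆ _)
      have h2 : ContinuousOn (fun q : (Fin n → ℝ) × ℝ => u q.1 0) (K ×ˢ Icc 0 t₁) :=
        hf₀.continuousOn.comp continuousOn_fst fun q hq => hq.1
      have h3 := hφ.continuous
      exact ((h1.sub h2).sub (by fun_prop)).sub (by fun_prop)
    obtain ⟨⟨x, t⟩, ⟨hx, ht⟩, hmax⟩ := hcyl.exists_isMaxOn hcyl_ne hWc
    replace hmax : ∀ y ∈ K, ∀ s ∈ Icc 0 t₁, u y s - u y 0 - (C + η) * s - ε * φ y ≤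
        u x t - u x 0 - (C + η) * t - ε * φ x := fun y hy s hs => hmax (show (y, s) ∈ _ from ⟨hy, hs⟩)
    change x ∈ K at hx
    change t ∈ Icc 0 t₁ at ht
    suffices hle : u x t - u x 0 - (C + η) * t - ε * φ x ≤ 0 from
      fun y hy s hs => (hmax y hy s hs).trans hle
    by_contra! hpos
    have ht0 : 0 < t := by
      refine lt_of_le_of_ne ht.1 fun h0 => ?_
      subst h0
      have := mul_nonneg hε.le (hφ0 x)
      linarith
    have hft : ContDiffOn ℝ (⊤ : ℕ∞) (fun y => u y t) K := hu.contDiffOn_slice (hIcc ht)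
    have hxmax : IsMaxOn (fun y => u y t - f₀ y - ε * φ y) K x := fun y hy => by
      have := hmax y hy t ht
      change u y t - u y 0 - ε * φ y ≤ u x t - u x 0 - ε * φ x
      linarith
    by_cases hxΩ : x ∈ Ω
    · have hut : C + η ≤ derivWithin (fun s => u x s) (Ico 0 T) t :=
        hu.le_derivWithin_of_max hx ht0 (hIcc ht).2 fun s hs => by
          have := hmax x hx s ⟨hs.1, hs.2.trans ht.2⟩
          linarith
      have hxK := hKnhds x hxΩ
      have hlmax : IsLocalMax (fun y => u y t - f₀ y - ε * φ y) x := hxmax.isLocalMax hxK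
      have hS := hu.spacelike x hx t (hIcc ht)
      simp only [spGradSq, spGrad] at hS
      rw [fderivWithin_of_mem_nhds hxK] at hS
      have hHx := hHε x hx
      simp only [H] at hHx
      rw [fderivWithin_fderivWithin_of_mem_nhds hxK, fderivWithin_of_mem_nhds hxK] at hHx
      rw [hu.derivWithin_eq_mcOp hΩo hxΩ (hIcc ht)] at hut
      linarith [mcOp_le_of_isLocalMax ((hft.contDiffAt hxK).of_le ENat.LEInfty.out)
        (hf₀2.contDiffAt hxK) hφ2.contDiffAt hlmax hS]
    · have hxfr : x ∈ frontier Ω := ⟨hx, by rwa [hΩo.interior_eq]⟩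
      obtain ⟨μ, e, hμ, he, hφx⟩ := hφγ x hxfr
      exact hu.not_isMaxOn_of_mem_frontier hΩo hΩconv hΩne hγunit hγout hγc hxfr (hIcc ht) h0T hc
        (hcS x hx t ht) (hcS x hx 0 (left_mem_Icc.2 ht₁.1)) hδL (hφ.differentiable (by simp) x) hμ
        he hφx hε hxmax
  have hη : ∀ η > 0, u x₁ t₁ - u x₁ 0 - (C + η) * t₁ ≤ 0 := by
    intro η hη
    have hev : ∀ᶠ ε in nhds (0 : ℝ), ∀ y ∈ K, y ∈ K → H ε y < C + η := by
      refine hKc.eventually_forall_of_forall_eventually (P := fun ε y => y ∈ K → H ε y < C + η)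
        fun y hy => ?_
      have h1 : H 0 y < C + η := (hH0 y hy).trans_lt (by linarith)
      have h2 := (hHc y hy).eventually (gt_mem_nhds h1)
      filter_upwards [eventually_nhdsWithin_iff.1 h2] with z hz hzK
      exact hz ⟨mem_univ _, hzK⟩
    have hlim : Filter.Tendsto (fun ε : ℝ => u x₁ t₁ - u x₁ 0 - (C + η) * t₁ - ε * φ x₁)
        (nhdsWithin 0 (Ioi 0)) (nhds (u x₁ t₁ - u x₁ 0 - (C + η) * t₁)) := by
      have : Continuous fun ε : ℝ => u x₁ t₁ - u x₁ 0 - (C + η) * t₁ - ε * φ x₁ := by fun_prop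
      simpa using (this.tendsto 0).mono_left nhdsWithin_le_nhds
    refine le_of_tendsto hlim ?_
    filter_upwards [nhdsWithin_le_nhds hev, self_mem_nhdsWithin] with ε hε hε0
    exact hbarrier η hη ε hε0 (fun y hy => hε y hy hy) x₁ hx₁ t₁ (right_mem_Icc.2 ht₁.1)
  have hlim : Filter.Tendsto (fun η : ℝ => u x₁ t₁ - u x₁ 0 - (C + η) * t₁)
      (nhdsWithin 0 (Ioi 0)) (nhds (u x₁ t₁ - u x₁ 0 - C * t₁)) := by
    have : Continuous fun η : ℝ => u x₁ t₁ - u x₁ 0 - (C + η) * t₁ := by fun_prop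
    simpa using (this.tendsto 0).mono_left nhdsWithin_le_nhds
  have := le_of_tendsto hlim (eventually_mem_nhdsWithin.mono hη)
  linarith

end Flow

/-- **Height bound** (equation `uest`): for a smooth solution of graphical spacelike
mean curvature flow with `α`-Neumann boundary condition on a compact convex smooth
domain `Ω ⊂ ℝⁿ` with initial value `u₀ = u(·,0)`, one has
`|u(x,t)| ≤ sup_Ω|u₀| + t·C_H`, where `C_H = sup_Ω |u_t(·,0)|`. -/
theorem height_bound
    {n : ℕ} (Ω : Set (Fin n → ℝ)) (hΩo : IsOpen Ω) (hΩconv : Convex ℝ Ω)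
    (hΩbd : Bornology.IsBounded Ω) (hΩne : Ω.Nonempty)
    -- `γ` is the outward unit normal of the smooth boundary `∂Ω`
    (γ : (Fin n → ℝ) → Fin n → ℝ)
    (hγunit : ∀ x ∈ frontier Ω, ∑ i, (γ x i) ^ 2 = 1)
    (hγout : ∀ x ∈ frontier Ω, ∀ y ∈ Ω, ∑ i, γ x i * (y i - x i) ≤ 0)
    (hγs : ContDiffOn ℝ (⊤ : ℕ∞) γ (frontier Ω))
    -- smooth boundary angle prescription
    (α : (Fin n → ℝ) → ℝ) (hαs : ContDiffOn ℝ (⊤ : ℕ∞) α (frontier Ω))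
    -- the solution
    (T : ℝ) (hT : 0 < T)
    (u : (Fin n → ℝ) → ℝ → ℝ)
    (hu : IsGraphMCF Ω γ α (Ico 0 T) u)
    -- M = sup_Ω |u₀| for the initial value u₀ = u(·,0)
    (M : ℝ) (hM : ∀ x ∈ Ω, |u x 0| ≤ M)
    -- C_H = sup_Ω |u_t(·,0)|
    (CH : ℝ) (hCH : ∀ x ∈ Ω, |derivWithin (fun s => u x s) (Ico 0 T) 0| ≤ CH) :
    ∀ x ∈ closure Ω, ∀ t ∈ Ico (0 : ℝ) T,
      |u x t| ≤ M + t * CH := by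
  have hγunit' : ∀ x ∈ frontier Ω, ‖WithLp.toLp 2 (γ x)‖ = 1 := fun x hx => by
    rw [EuclideanSpace.norm_eq]
    simp [hγunit x hx]
  have hKu : UniqueDiffOn ℝ (closure Ω) := uniqueDiffOn_convex hΩconv.closure
    (hΩne.mono (interior_maximal subset_closure hΩo))
  have h0T : (0 : ℝ) ∈ Ico 0 T := ⟨le_rfl, hT⟩
  intro x hx t ht
  have hxM : |u x 0| ≤ M :=
    le_on_closure (g := fun _ => M) hM (hu.contDiffOn_slice h0T).continuousOn.abs
      continuousOn_const hx
  have hup := hu.le_initial_add hΩo hΩconv hΩbd hΩne hγunit' hγout hγs.continuousOn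
    (fun y hy => (abs_le.1 (hCH y hy)).2) hx ht
  have hlow := (hu.neg hKu).le_initial_add hΩo hΩconv hΩbd hΩne hγunit' hγout
    hγs.continuousOn (C := CH) (fun y hy => by
      rw [derivWithin.fun_neg]
      linarith [(abs_le.1 (hCH y hy)).1]) hx ht
  rw [abs_le] at hxM ⊢
  constructor <;> linarith
end
end

section
/- Let U ⊂ ℝ^{n+1} be open, p ∈ U, and let ν, μ : U → ℝ^{n+1} be C¹ vector fields with η(ν,ν) ≡ −1, η(μ,μ) ≡ 1 and η(μ,e) ≡ 0 on U. Define α := η(ν,μ), v := −η(ν,e), and at p set μ⊤ := μ + αν, ν^Σ := ν − αμ, e^τ := e − (v/(1+α²))ν^Σ. Assume that at p: D_e μ(p) = 0, and Dν(p) is η-self-adjoint on ν(p)^⊥ (i.e. η(D_X ν, Y) = η(D_Y ν, X) whenever η(X,ν(p)) = η(Y,ν(p)) = 0). Then at p, D_{μ⊤} v = (v/(1+α²)) [ α·A(μ⊤, μ⊤) − A^Σ(ν^Σ, ν^Σ) ] − D_{e^τ} α, where A(X,Y) := η(D_X ν, Y) and A^Σ(X,Y) := η(D_X μ, Y). -/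
noncomputable section

/-- The Minkowski inner product `η` on `ℝ^{n+1}`:
`η(x,y) = ∑_{i=1}^n xᵢyᵢ - x_{n+1}y_{n+1}`. -/
def eta {n : ℕ} (x y : Fin (n + 1) → ℝ) : ℝ :=
  (∑ i : Fin n, x i.castSucc * y i.castSucc) - x (Fin.last n) * y (Fin.last n)

/-- The timelike coordinate vector `e := e_{n+1}`, with `η(e,e) = -1`. -/
def eVec (n : ℕ) : Fin (n + 1) → ℝ := Pi.single (Fin.last n) 1

section Eta

variable {n : ℕ}

lemma eta_comm (x y : Fin (n + 1) → ℝ) : eta x y = eta y x := by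
  simp only [eta, mul_comm]

lemma eta_add_left (x y z : Fin (n + 1) → ℝ) : eta (x + y) z = eta x z + eta y z := by
  simp only [eta, Pi.add_apply, add_mul, Finset.sum_add_distrib]
  ring

lemma eta_smul_left (c : ℝ) (x y : Fin (n + 1) → ℝ) : eta (c • x) y = c * eta x y := by
  simp only [eta, Pi.smul_apply, smul_eq_mul, mul_assoc, mul_sub, Finset.mul_sum]

lemma eta_add_right (x y z : Fin (n + 1) → ℝ) : eta x (y + z) = eta x y + eta x z := by
  rw [eta_comm, eta_add_left, eta_comm y, eta_comm z]

lemma eta_smul_right (c : ℝ) (x y : Fin (n + 1) → ℝ) : eta x (c • y) = c * eta x y := by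
  rw [eta_comm, eta_smul_left, eta_comm]

lemma eta_sub_left (x y z : Fin (n + 1) → ℝ) : eta (x - y) z = eta x z - eta y z := by
  rw [eq_sub_iff_add_eq, ← eta_add_left, sub_add_cancel]

lemma eta_sub_right (x y z : Fin (n + 1) → ℝ) : eta x (y - z) = eta x y - eta x z := by
  rw [eta_comm, eta_sub_left, eta_comm y, eta_comm z]

/-- The Minkowski inner product as a continuous bilinear map. -/
def etaCLM (n : ℕ) : (Fin (n + 1) → ℝ) →L[ℝ] (Fin (n + 1) → ℝ) →L[ℝ] ℝ :=
  LinearMap.toContinuousBilinearMap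
    (LinearMap.mk₂ ℝ eta eta_add_left eta_smul_left eta_add_right eta_smul_right)

lemma etaCLM_apply (x y : Fin (n + 1) → ℝ) : etaCLM n x y = eta x y := rfl

variable {f g : (Fin (n + 1) → ℝ) → Fin (n + 1) → ℝ} {p : Fin (n + 1) → ℝ}

lemma fderiv_eta_apply (hf : DifferentiableAt ℝ f p) (hg : DifferentiableAt ℝ g p)
    (X : Fin (n + 1) → ℝ) :
    fderiv ℝ (fun x => eta (f x) (g x)) p X =
      eta (fderiv ℝ f p X) (g p) + eta (f p) (fderiv ℝ g p X) := by
  have h := congrArg (fun L => L X) ((etaCLM n).fderiv_of_bilinear hf hg)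
  simp only [add_apply, ContinuousLinearMap.precompR_apply,
    ContinuousLinearMap.precompL_apply, etaCLM_apply] at h
  rw [h, add_comm]
  rfl

lemma fderiv_eta_const_apply (hf : DifferentiableAt ℝ f p) (w X : Fin (n + 1) → ℝ) :
    fderiv ℝ (fun x => eta (f x) w) p X = eta (fderiv ℝ f p X) w := by
  have h := fderiv_eta_apply hf (differentiableAt_const w) X
  have h0 : eta (f p) 0 = 0 := by simp [eta]
  simpa [h0] using h

lemma eta_fderiv_self_eq_zero (hf : DifferentiableAt ℝ f p) {c : ℝ}
    (h : ∀ᶠ x in nhds p, eta (f x) (f x) = c) (X : Fin (n + 1) → ℝ) :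
    eta (fderiv ℝ f p X) (f p) = 0 := by
  have h1 := fderiv_eta_apply hf hf X
  have h2 : (fun x => eta (f x) (f x)) =ᶠ[nhds p] fun _ => c := h
  rw [h2.fderiv_eq, fderiv_const_apply, zero_apply, eta_comm (f p)] at h1
  linarith

end Eta

/-- **Lemma `bdryv`** (boundary derivative of the gradient function): let `ν, μ` be
`C¹` fields on an open `U ⊂ ℝ^{n+1}` with `η(ν,ν) ≡ -1`, `η(μ,μ) ≡ 1`, `η(μ,e) ≡ 0`.
Set `α = η(ν,μ)`, `v = -η(ν,e)` and, at `p`, `μ⊤ = μ + αν`, `ν^Σ = ν - αμ`,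
`e^τ = e - (v/(1+α²))ν^Σ`.  If at `p` we have `D_e μ = 0` and `Dν` is
`η`-self-adjoint on `ν(p)^⊥`, then
`D_{μ⊤} v = (v/(1+α²))[α A(μ⊤,μ⊤) - A^Σ(ν^Σ,ν^Σ)] - D_{e^τ} α`,
where `A(X,Y) = η(D_X ν, Y)` and `A^Σ(X,Y) = η(D_X μ, Y)`. -/
theorem boundary_derivative_of_v
    {n : ℕ} (U : Set (Fin (n + 1) → ℝ)) (hU : IsOpen U)
    (ν μ : (Fin (n + 1) → ℝ) → Fin (n + 1) → ℝ)
    (hν : ContDiffOn ℝ 1 ν U) (hμ : ContDiffOn ℝ 1 μ U)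
    (hνunit : ∀ x ∈ U, eta (ν x) (ν x) = -1)
    (hμunit : ∀ x ∈ U, eta (μ x) (μ x) = 1)
    (hμe : ∀ x ∈ U, eta (μ x) (eVec n) = 0)
    (p : Fin (n + 1) → ℝ) (hp : p ∈ U)
    (α v : ℝ) (hα : α = eta (ν p) (μ p)) (hv : v = -eta (ν p) (eVec n))
    (μtop νSig eτ : Fin (n + 1) → ℝ)
    (hμtop : μtop = μ p + α • ν p) (hνSig : νSig = ν p - α • μ p)
    (heτ : eτ = eVec n - (v / (1 + α ^ 2)) • νSig)
    -- the cylinder normal is extended vertically: `D_e μ(p) = 0`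
    (hdeμ : fderiv ℝ μ p (eVec n) = 0)
    -- `Dν(p)` is `η`-self-adjoint on `ν(p)^⊥`
    (hsym : ∀ X Y : Fin (n + 1) → ℝ, eta X (ν p) = 0 → eta Y (ν p) = 0 →
      eta (fderiv ℝ ν p X) Y = eta (fderiv ℝ ν p Y) X) :
    fderiv ℝ (fun x => -eta (ν x) (eVec n)) p μtop =
      (v / (1 + α ^ 2)) *
        (α * eta (fderiv ℝ ν p μtop) μtop - eta (fderiv ℝ μ p νSig) νSig) -
      fderiv ℝ (fun x => eta (ν x) (μ x)) p eτ := by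
  have hUp : U ∈ nhds p := hU.mem_nhds hp
  have hνd : DifferentiableAt ℝ ν p := (hν.contDiffAt hUp).differentiableAt one_ne_zero
  have hμd : DifferentiableAt ℝ μ p := (hμ.contDiffAt hUp).differentiableAt one_ne_zero
  have hνν : ∀ X, eta (fderiv ℝ ν p X) (ν p) = 0 :=
    eta_fderiv_self_eq_zero hνd (Filter.eventually_of_mem hUp hνunit)
  have hμμ : ∀ X, eta (fderiv ℝ μ p X) (μ p) = 0 :=
    eta_fderiv_self_eq_zero hμd (Filter.eventually_of_mem hUp hμunit)
  have hν1 := hνunit p hp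
  have hμν : eta (μ p) (ν p) = α := by rw [hα, eta_comm]
  have heν : eta (eVec n) (ν p) = -v := by rw [hv, eta_comm, neg_neg]
  have hc : v / (1 + α ^ 2) * (1 + α ^ 2) = v := div_mul_cancel₀ v (by positivity)
  set c := v / (1 + α ^ 2)
  have hμtopν : eta μtop (ν p) = 0 := by
    rw [hμtop, eta_add_left, eta_smul_left, hμν, hν1]
    ring
  have heτν : eta eτ (ν p) = 0 := by
    rw [heτ, hνSig, eta_sub_left, eta_smul_left, eta_sub_left, eta_smul_left, hμν, hν1, heν]
    linear_combination hc
  have hs := hsym μtop eτ hμtopν heτν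
  have hNtop : ∀ X, eta (fderiv ℝ ν p X) μtop = eta (fderiv ℝ ν p X) (μ p) := fun X => by
    rw [hμtop, eta_add_right, eta_smul_right, hνν, mul_zero, add_zero]
  have hNSig : ∀ X, eta (fderiv ℝ ν p X) νSig = -α * eta (fderiv ℝ ν p X) (μ p) := fun X => by
    rw [hνSig, eta_sub_right, eta_smul_right, hνν]
    ring
  have hMSig : ∀ X, eta (fderiv ℝ μ p X) νSig = eta (fderiv ℝ μ p X) (ν p) := fun X => by
    rw [hνSig, eta_sub_right, eta_smul_right, hμμ, mul_zero, sub_zero]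
  have hMτ : fderiv ℝ μ p eτ = -c • fderiv ℝ μ p νSig := by
    rw [heτ, map_sub, map_smul, hdeμ, zero_sub, neg_smul]
  have hNe : eta (fderiv ℝ ν p μtop) eτ =
      eta (fderiv ℝ ν p μtop) (eVec n) - c * eta (fderiv ℝ ν p μtop) νSig := by
    rw [heτ, eta_sub_right, eta_smul_right]
  rw [fderiv_fun_neg, neg_apply, fderiv_eta_const_apply hνd,
    fderiv_eta_apply hνd hμd, hMτ, eta_smul_right, eta_comm (ν p), hMSig, hNtop]
  rw [hNtop] at hs
  rw [hNSig] at hNe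
  linear_combination hNe - hs
end
end

section
/- Let U ⊂ ℝ³ be open, p ∈ U, and let ν, μ : U → ℝ³ be C¹ vector fields with η(ν,ν) ≡ −1, η(μ,μ) ≡ 1, η(μ,e) ≡ 0 on U (e = e₃). Set α := η(ν,μ), v := −η(ν,e), and at p set ν^Σ := ν − αμ, e^τ := e − (v/(1+α²))ν^Σ. Assume at p: (i) v² > 1 + α²; (ii) Dμ(p)X = κ·(X − η(X,μ)μ + η(X,e)e) for all X ∈ ℝ³, where κ > 0 (cylinder over a strictly convex curve); (iii) Dν(p) is η-self-adjoint on ν(p)^⊥; (iv) D_{e^τ} v(p) = 0; (v) D_e α(p) = 0 and |D_V α(p)| ≤ C_α, where V is a unit vector with η(V,V) = 1, η(V,e) = η(V,μ) = 0. Then, with T := √(1+α²)·(v²−1−α²)^{−1/2}·e^τ, one has A(T,T) ≥ α·κ·v²/(1+α²) − |α|·v²·C_α/√((1+α²)(v²−1−α²)), where A(X,Y) := η(D_X ν, Y). -/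
noncomputable section

/-- The Minkowski inner product on `ℝ³`: `η(x,y) = x₁y₁ + x₂y₂ - x₃y₃`. -/
def eta3 (x y : Fin 3 → ℝ) : ℝ := x 0 * y 0 + x 1 * y 1 - x 2 * y 2

/-- The timelike coordinate vector `e := e₃`, with `η(e,e) = -1`. -/
def e3 : Fin 3 → ℝ := ![0, 0, 1]

/-- The Leibniz rule for the Minkowski inner product of two vector fields. -/
theorem fderiv_eta3_apply {f g : (Fin 3 → ℝ) → Fin 3 → ℝ} {p : Fin 3 → ℝ}
    (hf : DifferentiableAt ℝ f p) (hg : DifferentiableAt ℝ g p) (X : Fin 3 → ℝ) :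
    fderiv ℝ (fun x => eta3 (f x) (g x)) p X =
      eta3 (fderiv ℝ f p X) (g p) + eta3 (f p) (fderiv ℝ g p X) := by
  have hf' := hasFDerivAt_pi'.1 hf.hasFDerivAt
  have hg' := hasFDerivAt_pi'.1 hg.hasFDerivAt
  have h := (((hf' 0).mul (hg' 0)).add ((hf' 1).mul (hg' 1))).sub ((hf' 2).mul (hg' 2))
  have h' : fderiv ℝ (fun x => eta3 (f x) (g x)) p = _ := h.fderiv
  rw [h']
  simp only [eta3, sub_apply, add_apply, smul_apply, ContinuousLinearMap.comp_apply,
    ContinuousLinearMap.proj_apply, smul_eq_mul]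
  ring

/-- The lower bound for `S / (1 + α²)` when `S = v²ακ - v²αd/β`, where `β² = v² - 1 - α²` and
`|d| ≤ C`. -/
theorem tangent_bound_of_eq {α β v κ d C S : ℝ} (hβ : β ^ 2 = v ^ 2 - 1 - α ^ 2)
    (hpos : 0 < v ^ 2 - 1 - α ^ 2) (hd : |d| ≤ C)
    (hS : β * S = v ^ 2 * α * κ * β - v ^ 2 * α * d) :
    S / (1 + α ^ 2) ≥ α * κ * v ^ 2 / (1 + α ^ 2) -
      |α| * v ^ 2 * C / Real.sqrt ((1 + α ^ 2) * (v ^ 2 - 1 - α ^ 2)) := by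
  have hβ0 : β ≠ 0 := by
    rintro rfl
    linarith
  have hq : 0 < 1 + α ^ 2 := by positivity
  have hC : 0 ≤ C := (abs_nonneg d).trans hd
  have hS' : S = v ^ 2 * α * κ - v ^ 2 * α * d / β := by
    field_simp
    linarith
  have hroot : Real.sqrt ((1 + α ^ 2) * (v ^ 2 - 1 - α ^ 2)) ≤ (1 + α ^ 2) * |β| := by
    rw [← hβ, Real.sqrt_mul hq.le, Real.sqrt_sq_eq_abs]
    gcongr
    exact Real.sqrt_le_self_iff.2 (Or.inr (by nlinarith [sq_nonneg α]))
  have herr : v ^ 2 * α * d / β / (1 + α ^ 2) ≤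
      |α| * v ^ 2 * C / Real.sqrt ((1 + α ^ 2) * (v ^ 2 - 1 - α ^ 2)) := by
    calc v ^ 2 * α * d / β / (1 + α ^ 2)
        ≤ |v ^ 2 * α * d / β / (1 + α ^ 2)| := le_abs_self _
      _ = |α| * v ^ 2 * |d| / ((1 + α ^ 2) * |β|) := by
          rw [abs_div, abs_div, abs_mul, abs_mul, abs_of_pos hq, abs_of_nonneg (sq_nonneg v),
            div_div]
          ring
      _ ≤ _ := by
          gcongr
  have hsplit : S / (1 + α ^ 2) =
      α * κ * v ^ 2 / (1 + α ^ 2) - v ^ 2 * α * d / β / (1 + α ^ 2) := by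
    rw [hS']
    ring
  linarith

/-- **Lower bound for `A(T,T)`** at a boundary critical point of the gradient
function on a cylinder over a strictly convex curve: under the hypotheses
(i) `v² > 1+α²`, (ii) `Dμ(p) X = κ(X - η(X,μ)μ + η(X,e)e)` with `κ > 0`,
(iii) `Dν(p)` `η`-self-adjoint on `ν(p)^⊥`, (iv) `D_{e^τ} v(p) = 0`,
(v) `D_e α(p) = 0` and `|D_V α(p)| ≤ C_α` for unit horizontal tangents `V`,
one has, for `T = √(1+α²)(v²-1-α²)^{-1/2} e^τ`,
`A(T,T) ≥ ακv²/(1+α²) - |α|v²C_α/√((1+α²)(v²-1-α²))`. -/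
theorem second_fundamental_form_tangent_bound
    (U : Set (Fin 3 → ℝ)) (hU : IsOpen U)
    (ν μ : (Fin 3 → ℝ) → Fin 3 → ℝ)
    (hν : ContDiffOn ℝ 1 ν U) (hμ : ContDiffOn ℝ 1 μ U)
    (hνunit : ∀ x ∈ U, eta3 (ν x) (ν x) = -1)
    (hμunit : ∀ x ∈ U, eta3 (μ x) (μ x) = 1)
    (hμe : ∀ x ∈ U, eta3 (μ x) e3 = 0)
    (p : Fin 3 → ℝ) (hp : p ∈ U)
    (α v : ℝ) (hα : α = eta3 (ν p) (μ p)) (hv : v = -eta3 (ν p) e3)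
    (νSig eτ : Fin 3 → ℝ)
    (hνSig : νSig = ν p - α • μ p)
    (heτ : eτ = e3 - (v / (1 + α ^ 2)) • νSig)
    -- (i)
    (hbig : v ^ 2 > 1 + α ^ 2)
    -- (ii): cylinder over a strictly convex curve of curvature `κ > 0`
    (κ : ℝ) (hκ : 0 < κ)
    (hDμ : ∀ X : Fin 3 → ℝ,
      fderiv ℝ μ p X = κ • (X - eta3 X (μ p) • μ p + eta3 X e3 • e3))
    -- (iii): `Dν(p)` is `η`-self-adjoint on `ν(p)^⊥`
    (hsymν : ∀ X Y : Fin 3 → ℝ, eta3 X (ν p) = 0 → eta3 Y (ν p) = 0 →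
      eta3 (fderiv ℝ ν p X) Y = eta3 (fderiv ℝ ν p Y) X)
    -- (iv): critical point of the gradient function in the direction `e^τ`
    (hcrit : fderiv ℝ (fun x => -eta3 (ν x) e3) p eτ = 0)
    -- (v): the boundary angle is graphical with tangential derivative bound `C_α`
    (Cα : ℝ)
    (hgraph : fderiv ℝ (fun x => eta3 (ν x) (μ x)) p e3 = 0)
    (htan : ∀ V : Fin 3 → ℝ, eta3 V V = 1 → eta3 V e3 = 0 → eta3 V (μ p) = 0 →
      |fderiv ℝ (fun x => eta3 (ν x) (μ x)) p V| ≤ Cα)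
    (T : Fin 3 → ℝ)
    (hT : T = (Real.sqrt (1 + α ^ 2) / Real.sqrt (v ^ 2 - 1 - α ^ 2)) • eτ) :
    eta3 (fderiv ℝ ν p T) T ≥
      α * κ * v ^ 2 / (1 + α ^ 2) -
        |α| * v ^ 2 * Cα / Real.sqrt ((1 + α ^ 2) * (v ^ 2 - 1 - α ^ 2)) := by
  have hdν : DifferentiableAt ℝ ν p :=
    (hν.differentiableOn one_ne_zero).differentiableAt (hU.mem_nhds hp)
  have hdμ : DifferentiableAt ℝ μ p :=
    (hμ.differentiableOn one_ne_zero).differentiableAt (hU.mem_nhds hp)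
  have hμ2 : μ p 2 = 0 := by simpa [eta3, e3] using hμe p hp
  have hv2 : ν p 2 = v := by simp [hv, eta3, e3]
  have hμ1 : μ p 0 ^ 2 + μ p 1 ^ 2 = 1 := by
    have := hμunit p hp
    simp only [eta3, hμ2] at this
    linarith
  have hα' : α = ν p 0 * μ p 0 + ν p 1 * μ p 1 := by simp [hα, eta3, hμ2]
  have hν1 : ν p 0 ^ 2 + ν p 1 ^ 2 = v ^ 2 - 1 := by
    have := hνunit p hp
    simp only [eta3, hv2] at this
    linarith
  -- the horizontal unit tangent of the cylinder, and the component of `ν` along it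
  set W : Fin 3 → ℝ := ![-μ p 1, μ p 0, 0] with hW
  obtain ⟨β, hβ⟩ : ∃ β, β = ν p 1 * μ p 0 - ν p 0 * μ p 1 := ⟨_, rfl⟩
  have hν0' : ν p 0 = α * μ p 0 - β * μ p 1 := by
    rw [hα', hβ]
    linear_combination (-ν p 0) * hμ1
  have hν1' : ν p 1 = α * μ p 1 + β * μ p 0 := by
    rw [hα', hβ]
    linear_combination (-ν p 1) * hμ1
  have hβsq : β ^ 2 = v ^ 2 - 1 - α ^ 2 := by
    rw [hν0', hν1'] at hν1
    linear_combination hν1 - (α ^ 2 + β ^ 2) * hμ1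
  have hpos : 0 < v ^ 2 - 1 - α ^ 2 := by linarith
  have hβ0 : β ≠ 0 := by
    rintro rfl
    linarith
  have hq : 0 < 1 + α ^ 2 := by positivity
  set E : Fin 3 → ℝ := β • e3 + v • W with hE
  have hE0 : E 0 = -(v * μ p 1) := by simp [hE, hW, e3]
  have hE1 : E 1 = v * μ p 0 := by simp [hE, hW, e3]
  have hE2 : E 2 = β := by simp [hE, hW, e3]
  have heE : eτ = (-(β / (1 + α ^ 2))) • E := by
    rw [heτ, hνSig]
    ext i
    fin_cases i
    · simp [hE, hW, e3, hν0']
      ring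
    · simp [hE, hW, e3, hν1']
      ring
    · simp [hE, hW, e3, hv2, hμ2]
      field_simp
      linarith
  have hunit : eta3 (fderiv ℝ ν p E) (ν p) = 0 := by
    have hconst : (fun x => eta3 (ν x) (ν x)) =ᶠ[nhds p] fun _ => (-1 : ℝ) := by
      filter_upwards [hU.mem_nhds hp] with x hx using hνunit x hx
    have h := fderiv_eta3_apply hdν hdν E
    rw [hconst.fderiv_eq] at h
    simp [eta3] at h ⊢
    linarith
  have hvert : fderiv ℝ ν p E 2 = 0 := by
    have h := fderiv_eta3_apply hdν (differentiableAt_const e3) eτ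
    have hneg : fderiv ℝ (fun x => -eta3 (ν x) e3) p eτ =
        -fderiv ℝ (fun x => eta3 (ν x) e3) p eτ := by
      rw [fderiv_fun_neg]
      rfl
    rw [hneg, h, heE, map_smul] at hcrit
    simpa [eta3, e3, hβ0, hq.ne'] using hcrit
  set d := fderiv ℝ (fun x => eta3 (ν x) (μ x)) p W with hd
  have hdC : |d| ≤ Cα := by
    apply htan
    · simp [eta3, hW]
      linarith
    · simp [eta3, hW, e3]
    · simp [eta3, hW, hμ2]
      ring
  have hangle : eta3 (fderiv ℝ ν p E) (μ p) = v * d - κ * v * β := by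
    have h := fderiv_eta3_apply hdν hdμ E
    have hlin : fderiv ℝ (fun x => eta3 (ν x) (μ x)) p E = v * d := by
      rw [hE, map_add, map_smul, map_smul, hgraph, hd]
      simp
    have hDμE : eta3 (ν p) (fderiv ℝ μ p E) = κ * v * β := by
      have hEμ : eta3 E (μ p) = 0 := by
        simp only [eta3, hE0, hE1, hE2, hμ2]
        ring
      have hEe : eta3 E e3 = -β := by simp [eta3, e3, hE2]
      have he : e3 0 = 0 ∧ e3 1 = 0 ∧ e3 2 = 1 := by simp [e3]
      rw [hDμ, hEμ, hEe]
      simp only [eta3, Pi.smul_apply, Pi.add_apply, Pi.sub_apply, smul_eq_mul, he.1, he.2.1,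
        he.2.2, hE0, hE1, hE2, hv2, hν0', hν1']
      linear_combination (κ * v * β) * hμ1
    linarith
  have hval : β * eta3 (fderiv ℝ ν p E) E =
      v ^ 2 * α * κ * β - v ^ 2 * α * d := by
    simp only [eta3, hvert, hμ2, hv2, hν0', hν1'] at hunit hangle
    simp only [eta3, hvert, hE0, hE1, hE2]
    linear_combination v * hunit - v * α * hangle
  have hTT : eta3 (fderiv ℝ ν p T) T = eta3 (fderiv ℝ ν p E) E / (1 + α ^ 2) := by
    have hsmul : ∀ c : ℝ, eta3 (fderiv ℝ ν p (c • E)) (c • E) =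
        c ^ 2 * eta3 (fderiv ℝ ν p E) E := by
      intro c
      simp [eta3]
      ring
    rw [hT, heE, smul_smul, hsmul, mul_pow, div_pow, Real.sq_sqrt hq.le, Real.sq_sqrt hpos.le,
      neg_sq, div_pow, hβsq]
    field_simp
  rw [hTT]
  exact tangent_bound_of_eq hβsq hpos hdC hval
end
end
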